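/- If the finite alphabet A ⊆ ℕ (with |A| ≥ 2) satisfies δ_A > 1 − 1/(8 + √34) = 0.9276..., then the set of denominators arising from A has positive proportion: there exist a constant c > 0 and N₀ such that #D_A(N) ≥ c·N for all N ≥ N₀. -/

import Mathlib

/-- Value of the finite continued fraction `[d₁, d₂, …, d_k] = 1/(d₁ + 1/(d₂ + ⋯ + 1/d_k))`. -/
def cfValue : List ℕ → ℚ
  | [] => 0
  | d :: l => 1 / ((d : ℚ) + cfValue l)

/-- `R_A`: rationals admitting a finite continued fraction expansion with all
partial quotients in the alphabet `A`. -/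
def Rset (A : Finset ℕ) : Set ℚ :=
  {x | ∃ l : List ℕ, l ≠ [] ∧ (∀ d ∈ l, d ∈ A) ∧ cfValue l = x}

/-- `D_A(N)`: denominators `d ≤ N` of fractions `b/d ∈ R_A` with `gcd(b,d) = 1`. -/
def Dset (A : Finset ℕ) (N : ℕ) : Set ℕ :=
  {d | d ≤ N ∧ ∃ b : ℕ, Nat.gcd b d = 1 ∧ ((b : ℚ) / (d : ℚ)) ∈ Rset A}

/-- Iterates of the Gauss map (complete quotients, as remainders): `x₀ = x`,
`x_{n+1} = 1/x_n - ⌊1/x_n⌋`. -/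
noncomputable def gaussIter (x : ℝ) : ℕ → ℝ
  | 0 => x
  | n + 1 => 1 / gaussIter x n - ⌊1 / gaussIter x n⌋₊

/-- `E_A`: irrationals in `(0,1)` whose infinite continued fraction expansion has all
partial quotients `a_{n+1} = ⌊1/x_n⌋` in the alphabet `A`. -/
noncomputable def Eset (A : Finset ℕ) : Set ℝ :=
  {x | x ∈ Set.Ioo (0 : ℝ) 1 ∧ Irrational x ∧ ∀ n : ℕ, ⌊1 / gaussIter x n⌋₊ ∈ A}

/-- The matrix `∏ [[0, 1], [1, d]]` of a finite continued fraction. -/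
def cfMat : List ℕ → Matrix (Fin 2) (Fin 2) ℤ
  | [] => 1
  | d :: l => !![0, 1; 1, (d : ℤ)] * cfMat l

/-- The continuant of a word, i.e. the denominator of its continued fraction. -/
def cfDen (w : List ℕ) : ℤ := cfMat w 1 1

theorem cfMat_append (l l' : List ℕ) : cfMat (l ++ l') = cfMat l * cfMat l' := by
  induction l with
  | nil => simp [cfMat]
  | cons d l ih => simp [cfMat, ih]

theorem cfMat_append_apply (l l' : List ℕ) (i j : Fin 2) :
    cfMat (l ++ l') i j = cfMat l i 0 * cfMat l' 0 j + cfMat l i 1 * cfMat l' 1 j := by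
  simp [cfMat_append, Matrix.mul_apply, Fin.sum_univ_two]

theorem cfMat_cons_zero (d : ℕ) (l : List ℕ) (j : Fin 2) : cfMat (d :: l) 0 j = cfMat l 1 j := by
  simp [cfMat, Matrix.mul_apply, Fin.sum_univ_two]

theorem cfMat_cons_one (d : ℕ) (l : List ℕ) (j : Fin 2) :
    cfMat (d :: l) 1 j = cfMat l 0 j + d * cfMat l 1 j := by
  simp [cfMat, Matrix.mul_apply, Fin.sum_univ_two]

theorem cfMat_concat_zero (d : ℕ) (l : List ℕ) (i : Fin 2) :
    cfMat (l ++ [d]) i 0 = cfMat l i 1 := by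
  simp [cfMat_append_apply, cfMat]

theorem cfMat_concat_one (d : ℕ) (l : List ℕ) (i : Fin 2) :
    cfMat (l ++ [d]) i 1 = cfMat l i 0 + d * cfMat l i 1 := by
  simp [cfMat_append_apply, cfMat]; ring

theorem cfMat_det (l : List ℕ) :
    cfMat l 0 0 * cfMat l 1 1 - cfMat l 0 1 * cfMat l 1 0 = (-1) ^ l.length := by
  induction l with
  | nil => simp [cfMat]
  | cons d l ih =>
    simp only [cfMat_cons_zero, cfMat_cons_one, List.length_cons, pow_succ]
    linear_combination (-1 : ℤ) * ih

theorem cfMat_reverse (l : List ℕ) (i j : Fin 2) : cfMat l.reverse i j = cfMat l j i := by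
  induction l generalizing i j with
  | nil => fin_cases i <;> fin_cases j <;> simp [cfMat]
  | cons d l ih =>
    rw [List.reverse_cons]
    fin_cases j
    · simp only [Fin.zero_eta, cfMat_concat_zero, cfMat_cons_zero, ih]
    · simp only [Fin.mk_one, cfMat_concat_one, cfMat_cons_one, ih]

theorem cfDen_append (l l' : List ℕ) :
    cfDen (l ++ l') = cfMat l 1 0 * cfMat l' 0 1 + cfDen l * cfDen l' :=
  cfMat_append_apply l l' 1 1

theorem cfMat_bounds (l : List ℕ) (h : ∀ d ∈ l, 1 ≤ d) :
    0 ≤ cfMat l 0 0 ∧ 0 ≤ cfMat l 0 1 ∧ 0 ≤ cfMat l 1 0 ∧ 1 ≤ cfMat l 1 1 ∧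
    cfMat l 0 0 ≤ cfMat l 1 1 ∧ cfMat l 0 1 ≤ cfMat l 1 1 ∧ cfMat l 1 0 ≤ cfMat l 1 1 ∧
    cfMat l 0 0 + cfMat l 1 0 ≤ cfMat l 0 1 + cfMat l 1 1 := by
  induction l with
  | nil => simp [cfMat]
  | cons d l ih =>
    obtain ⟨h1, h2, h3, h4, h5, h6, h7, h8⟩ := ih fun x hx => h x (by simp [hx])
    have hd : (1 : ℤ) ≤ d := by exact_mod_cast h d (by simp)
    simp only [cfMat_cons_zero, cfMat_cons_one]
    refine ⟨h3, by linarith, ?_, ?_, ?_, ?_, ?_, ?_⟩ <;> nlinarith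

theorem cfMat_nonneg {l : List ℕ} (h : ∀ d ∈ l, 1 ≤ d) (i j : Fin 2) : 0 ≤ cfMat l i j := by
  obtain ⟨h1, h2, h3, h4, -⟩ := cfMat_bounds l h
  fin_cases i <;> fin_cases j <;> first | assumption | exact zero_le_one.trans h4

theorem one_le_cfDen {l : List ℕ} (h : ∀ d ∈ l, 1 ≤ d) : 1 ≤ cfDen l :=
  (cfMat_bounds l h).2.2.2.1

theorem cfMat_le_cfDen {l : List ℕ} (h : ∀ d ∈ l, 1 ≤ d) (i j : Fin 2) :
    cfMat l i j ≤ cfDen l := by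
  obtain ⟨h1, h2, h3, h4, h5, h6, h7, -⟩ := cfMat_bounds l h
  fin_cases i <;> fin_cases j <;> first | assumption | exact le_rfl

theorem cfDen_mul_le {l l' : List ℕ} (h : ∀ d ∈ l, 1 ≤ d) (h' : ∀ d ∈ l', 1 ≤ d) :
    cfDen l * cfDen l' ≤ cfDen (l ++ l') := by
  rw [cfDen_append]
  have := mul_nonneg (cfMat_nonneg h 1 0) (cfMat_nonneg h' 0 1)
  linarith

theorem cfDen_append_le {l l' : List ℕ} (h : ∀ d ∈ l, 1 ≤ d) (h' : ∀ d ∈ l', 1 ≤ d) :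
    cfDen (l ++ l') ≤ 2 * (cfDen l * cfDen l') := by
  rw [cfDen_append]
  have := mul_le_mul (cfMat_le_cfDen h 1 0) (cfMat_le_cfDen h' 0 1) (cfMat_nonneg h' 0 1)
    (zero_le_one.trans (one_le_cfDen h))
  linarith

theorem isCoprime_cfMat_row (l : List ℕ) : IsCoprime (cfMat l 1 0) (cfMat l 1 1) := by
  have h := cfMat_det l
  have h2 : ((-1 : ℤ) ^ l.length) * (-1) ^ l.length = 1 := by
    rw [← mul_pow]; simp
  exact ⟨-(-1) ^ l.length * cfMat l 0 1, (-1) ^ l.length * cfMat l 0 0, by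
    linear_combination (-1) ^ l.length * h + h2⟩

theorem isCoprime_cfMat_col (l : List ℕ) : IsCoprime (cfMat l 0 1) (cfMat l 1 1) := by
  have := isCoprime_cfMat_row l.reverse
  rwa [cfMat_reverse, cfMat_reverse] at this

/-- The entries are positive as soon as the word has two letters. -/
theorem cfMat_pos {l : List ℕ} (h : ∀ d ∈ l, 1 ≤ d) (hl : 2 ≤ l.length) (i j : Fin 2) :
    1 ≤ cfMat l i j := by
  match l, hl with
  | a :: b :: l, _ =>
    have ha : (1 : ℤ) ≤ a := by exact_mod_cast h a (by simp)
    have hb : (1 : ℤ) ≤ b := by exact_mod_cast h b (by simp)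
    obtain ⟨h1, h2, h3, h4, h5, h6, h7, h8⟩ :=
      cfMat_bounds l fun x hx => h x (by simp [hx])
    have key : 1 ≤ cfMat l 0 0 + b * cfMat l 1 0 := by
      rcases l.eq_nil_or_concat' with rfl | ⟨l', c, rfl⟩
      · simp [cfMat]
      · have h' : ∀ d ∈ l', 1 ≤ d := fun x hx => h x (by simp [hx])
        obtain ⟨k1, k2, k3, k4, -⟩ := cfMat_bounds l' h'
        rw [cfMat_concat_zero, cfMat_concat_zero]
        nlinarith
    fin_cases i <;> fin_cases j <;>
      simp only [Fin.zero_eta, Fin.mk_one, cfMat_cons_zero, cfMat_cons_one]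
    · exact key
    · nlinarith
    · nlinarith
    · nlinarith [mul_nonneg (sub_nonneg.2 ha) (by nlinarith : 0 ≤ cfMat l 0 1 + b * cfMat l 1 1)]

/-! ### Wedge products of bottom rows -/

/-- The wedge product of the bottom rows of two continued fraction matrices. -/
def cfWedge (w w' : List ℕ) : ℤ := cfMat w 1 0 * cfMat w' 1 1 - cfMat w 1 1 * cfMat w' 1 0

theorem cfWedge_append (w w' s : List ℕ) :
    cfWedge (w ++ s) (w' ++ s) = (-1) ^ s.length * cfWedge w w' := by
  simp only [cfWedge, cfMat_append_apply, ← cfMat_det]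
  ring

theorem abs_cfWedge_append (w w' s : List ℕ) :
    |cfWedge (w ++ s) (w' ++ s)| = |cfWedge w w'| := by
  rw [cfWedge_append, abs_mul, abs_pow]; simp

theorem cfWedge_comm (w w' : List ℕ) : cfWedge w' w = -cfWedge w w' := by
  simp only [cfWedge]; ring

theorem cfWedge_concat (w w' : List ℕ) (d d' : ℕ) :
    cfWedge (w ++ [d]) (w' ++ [d']) = (d' - d) * (cfDen w * cfDen w') +
      cfDen w * cfMat w' 1 0 - cfMat w 1 0 * cfDen w' := by
  simp only [cfWedge, cfMat_concat_zero, cfMat_concat_one, cfDen]; ring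

theorem cfWedge_concat_ge {w w' : List ℕ} (h : ∀ x ∈ w, 1 ≤ x) (h' : ∀ x ∈ w', 1 ≤ x)
    {d d' : ℕ} (hd : d < d') :
    cfDen w * cfMat w' 1 0 + (cfDen w - cfMat w 1 0) * cfDen w' ≤
      cfWedge (w ++ [d]) (w' ++ [d']) := by
  rw [cfWedge_concat]
  have h1 : (1 : ℤ) ≤ d' - d := by
    have : (d : ℤ) + 1 ≤ d' := by exact_mod_cast hd
    linarith
  have h2 : 0 ≤ cfDen w * cfDen w' :=
    mul_nonneg (zero_le_one.trans (one_le_cfDen h)) (zero_le_one.trans (one_le_cfDen h'))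
  nlinarith

/-- Distinct words of the same length share a longest common suffix. -/
theorem exists_common_suffix {w w' : List ℕ} (hl : w.length = w'.length) (hne : w ≠ w') :
    ∃ (x x' s : List ℕ) (d d' : ℕ), d ≠ d' ∧ x.length = x'.length ∧
      w = x ++ [d] ++ s ∧ w' = x' ++ [d'] ++ s := by
  induction w using List.reverseRecOn generalizing w' with
  | nil => exact absurd (List.length_eq_zero_iff.1 hl.symm).symm hne
  | append_singleton w d ih =>
    rcases w'.eq_nil_or_concat' with rfl | ⟨w', d', rfl⟩
    · simp at hl
    · have hl' : w.length = w'.length := by simpa using hl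
      by_cases hd : d = d'
      · subst hd
        obtain ⟨x, x', s, e, e', h1, h2, h3, h4⟩ := ih hl' fun e => hne (by rw [e])
        exact ⟨x, x', s ++ [d], e, e', h1, h2, by simp [h3], by simp [h4]⟩
      · exact ⟨w, w', [], d, d', hd, hl', by simp, by simp⟩

theorem cfWedge_ne_zero {w w' : List ℕ} (h : ∀ x ∈ w, 1 ≤ x) (h' : ∀ x ∈ w', 1 ≤ x)
    (hl : w.length = w'.length) (hne : w ≠ w') : cfWedge w w' ≠ 0 := by
  obtain ⟨x, x', s, d, d', hd, hlx, rfl, rfl⟩ := exists_common_suffix hl hne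
  have hx : ∀ e ∈ x, 1 ≤ e := fun e he => h e (by simp [he])
  have hx' : ∀ e ∈ x', 1 ≤ e := fun e he => h' e (by simp [he])
  have aux : ∀ y y' : List ℕ, (∀ e ∈ y, 1 ≤ e) → (∀ e ∈ y', 1 ≤ e) → y.length = y'.length →
      0 < cfDen y * cfMat y' 1 0 + (cfDen y - cfMat y 1 0) * cfDen y' := by
    intro y y' hy hy' hl
    have h1 := one_le_cfDen hy
    have h1' := one_le_cfDen hy'
    have h2 := cfMat_le_cfDen hy 1 0
    have h3 := cfMat_nonneg hy' 1 0
    rcases y'.eq_nil_or_concat' with rfl | ⟨z', e', rfl⟩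
    · have : y = [] := List.length_eq_zero_iff.1 hl
      subst this
      simp [cfMat, cfDen]
    · have : 1 ≤ cfMat (z' ++ [e']) 1 0 := by
        rw [cfMat_concat_zero]; exact one_le_cfDen fun e he => hy' e (by simp [he])
      nlinarith
  rw [← abs_pos, abs_cfWedge_append, abs_pos]
  rcases hd.lt_or_gt with hd | hd
  · exact ((aux x x' hx hx' hlx).trans_le (cfWedge_concat_ge hx hx' hd)).ne'
  · rw [cfWedge_comm, neg_ne_zero]
    exact ((aux x' x hx' hx hlx.symm).trans_le (cfWedge_concat_ge hx' hx hd)).ne'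

theorem cfDen_le_mul_of_concat {w : List ℕ} {d α : ℕ} (h : ∀ x ∈ w, 1 ≤ x) (hd : d ≤ α) :
    cfDen (w ++ [d]) ≤ (α + 1) * cfMat (w ++ [d]) 1 0 := by
  rw [cfDen, cfMat_concat_one, cfMat_concat_zero]
  have h1 := cfMat_le_cfDen h 1 0
  have h2 := one_le_cfDen h
  have h3 : (d : ℤ) ≤ α := by exact_mod_cast hd
  unfold cfDen at *
  nlinarith

/-- Rows sharing an initial word `g` and continued by distinct words are well separated. -/
theorem sq_cfDen_le_cfWedge {g w w' : List ℕ} {α : ℕ} (hg0 : g ≠ [])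
    (hg : ∀ x ∈ g, 1 ≤ x ∧ x ≤ α) (h : ∀ x ∈ w, 1 ≤ x ∧ x ≤ α) (h' : ∀ x ∈ w', 1 ≤ x ∧ x ≤ α)
    (hl : w.length = w'.length) (hne : w ≠ w') :
    cfDen g ^ 2 ≤ (α + 1) * |cfWedge (g ++ w) (g ++ w')| := by
  obtain ⟨x, x', s, d, d', hd, hlx, rfl, rfl⟩ := exists_common_suffix hl hne
  have hx : ∀ e ∈ x, 1 ≤ e ∧ e ≤ α := fun e he => h e (by simp [he])
  have hx' : ∀ e ∈ x', 1 ≤ e ∧ e ≤ α := fun e he => h' e (by simp [he])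
  have aux : ∀ (y y' : List ℕ) (d d' : ℕ), (∀ e ∈ y, 1 ≤ e ∧ e ≤ α) →
      (∀ e ∈ y', 1 ≤ e ∧ e ≤ α) → d < d' →
      cfDen g ^ 2 ≤ (α + 1) * |cfWedge (g ++ y ++ [d]) (g ++ y' ++ [d'])| := by
    intro y y' d d' hy hy' hdd
    have hgy : ∀ e ∈ g ++ y, 1 ≤ e ∧ e ≤ α := by
      intro e he; rcases List.mem_append.1 he with he | he
      exacts [hg e he, hy e he]
    have hgy' : ∀ e ∈ g ++ y', 1 ≤ e ∧ e ≤ α := by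
      intro e he; rcases List.mem_append.1 he with he | he
      exacts [hg e he, hy' e he]
    have k1 := cfWedge_concat_ge (fun e he => (hgy e he).1) (fun e he => (hgy' e he).1) hdd
    have k2 : cfDen (g ++ y') ≤ (α + 1) * cfMat (g ++ y') 1 0 := by
      rcases (g ++ y').eq_nil_or_concat' with h0 | ⟨z, e, h0⟩
      · simp at h0; exact absurd h0.1 hg0
      · rw [h0] at hgy' ⊢
        exact cfDen_le_mul_of_concat (fun e he => (hgy' e (by simp [he])).1)
          (hgy' e (by simp)).2
    have k3 : ∀ z : List ℕ, (∀ e ∈ z, 1 ≤ e ∧ e ≤ α) → cfDen g ≤ cfDen (g ++ z) := by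
      intro z hz
      have e1 := cfDen_mul_le (fun e he => (hg e he).1) (fun e he => (hz e he).1)
      have e2 := one_le_cfDen (fun e he => (hg e he).1)
      have e3 := one_le_cfDen (fun e he => (hz e he).1)
      nlinarith
    have k4 := k3 y hy
    have k5 := k3 y' hy'
    have k6 := one_le_cfDen (fun e he => (hg e he).1)
    have k7 := cfMat_le_cfDen (fun e he => (hgy e he).1) 1 0
    have k8 : cfDen (g ++ y) * cfMat (g ++ y') 1 0 ≤
        |cfWedge (g ++ y ++ [d]) (g ++ y' ++ [d'])| := by
      refine le_trans ?_ (k1.trans (le_abs_self _))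
      have := mul_nonneg (sub_nonneg.2 k7) (by linarith : 0 ≤ cfDen (g ++ y'))
      linarith
    calc cfDen g ^ 2 = cfDen g * cfDen g := sq _
      _ ≤ cfDen (g ++ y) * cfDen (g ++ y') := by gcongr; linarith
      _ ≤ cfDen (g ++ y) * ((α + 1) * cfMat (g ++ y') 1 0) := by gcongr; linarith
      _ = (α + 1) * (cfDen (g ++ y) * cfMat (g ++ y') 1 0) := by ring
      _ ≤ _ := by gcongr
  have e1 : g ++ (x ++ [d] ++ s) = (g ++ x ++ [d]) ++ s := by simp
  have e2 : g ++ (x' ++ [d'] ++ s) = (g ++ x' ++ [d']) ++ s := by simp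
  rw [e1, e2, abs_cfWedge_append]
  rcases hd.lt_or_gt with hd | hd
  · exact aux x x' d d' hx hx' hd
  · rw [cfWedge_comm, abs_neg]
    exact aux x' x d' d hx' hx hd

/-- The last column determines a word of given length. -/
theorem eq_of_cfMat_col_eq {w w' : List ℕ} (h : ∀ x ∈ w, 1 ≤ x) (h' : ∀ x ∈ w', 1 ≤ x)
    (hl : w.length = w'.length) (h0 : cfMat w 0 1 = cfMat w' 0 1)
    (h1 : cfMat w 1 1 = cfMat w' 1 1) : w = w' := by
  by_contra hne
  refine cfWedge_ne_zero (w := w.reverse) (w' := w'.reverse) (by simpa using h)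
    (by simpa using h') (by simpa using hl) (by simpa using hne) ?_
  simp only [cfWedge, cfMat_reverse, h0, h1]
  ring

/-! ### Codes: finite sets of words -/

/-- All words of the set have the same length. -/
def Uniform (F : Finset (List ℕ)) : Prop := ∀ w ∈ F, ∀ v ∈ F, w.length = v.length

/-- Corresponding matrix entries of words of the set differ by a factor at most `κ`. -/
def Pinned (κ : ℝ) (F : Finset (List ℕ)) : Prop :=
  ∀ w ∈ F, ∀ v ∈ F, ∀ i j, (cfMat w i j : ℝ) ≤ κ * cfMat v i j

/-- The set of concatenations. -/
def cat (F G : Finset (List ℕ)) : Finset (List ℕ) := Finset.image₂ (· ++ ·) F G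

theorem mem_cat {F G : Finset (List ℕ)} {w : List ℕ} :
    w ∈ cat F G ↔ ∃ x ∈ F, ∃ y ∈ G, x ++ y = w := by
  simp [cat, Finset.mem_image₂]

theorem cat_assoc (F G H : Finset (List ℕ)) : cat (cat F G) H = cat F (cat G H) :=
  Finset.image₂_assoc List.append_assoc

theorem nil_cat (F : Finset (List ℕ)) : cat {[]} F = F := by
  ext w; simp [mem_cat]

theorem sum_cat {E : Type*} [AddCommMonoid E] {F : Finset (List ℕ)} (hF : Uniform F)
    (G : Finset (List ℕ)) (f : List ℕ → E) :
    ∑ w ∈ cat F G, f w = ∑ x ∈ F, ∑ y ∈ G, f (x ++ y) := by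
  rw [← Finset.sum_product', cat, ← Finset.image_uncurry_product, Finset.sum_image]
  · rfl
  · rintro ⟨x, y⟩ h ⟨x', y'⟩ h' he
    simp only [Finset.coe_product, Set.mem_prod, Finset.mem_coe] at h h'
    obtain ⟨rfl, rfl⟩ := List.append_inj he (hF _ h.1 _ h'.1)
    rfl

theorem card_cat {F : Finset (List ℕ)} (hF : Uniform F) (G : Finset (List ℕ)) :
    (cat F G).card = F.card * G.card := by
  simp only [Finset.card_eq_sum_ones]
  rw [sum_cat hF]; simp

theorem Uniform.cat {F G : Finset (List ℕ)} (hF : Uniform F) (hG : Uniform G) :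
    Uniform (cat F G) := by
  intro w hw w' hw'
  obtain ⟨x, hx, y, hy, rfl⟩ := mem_cat.1 hw
  obtain ⟨x', hx', y', hy', rfl⟩ := mem_cat.1 hw'
  simp [hF x hx x' hx', hG y hy y' hy']

theorem uniform_singleton (w : List ℕ) : Uniform {w} := by
  simp [Uniform]

theorem pinned_singleton (w : List ℕ) : Pinned 1 {w} := by
  simp [Pinned]

theorem Pinned.cat {κ κ' : ℝ} {F G : Finset (List ℕ)} (hκ : 0 ≤ κ) (hF : Pinned κ F)
    (hG : Pinned κ' G) (hF1 : ∀ w ∈ F, ∀ d ∈ w, 1 ≤ d)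
    (hG1 : ∀ w ∈ G, ∀ d ∈ w, 1 ≤ d) : Pinned (κ * κ') (cat F G) := by
  intro w hw w' hw' i j
  obtain ⟨x, hx, y, hy, rfl⟩ := mem_cat.1 hw
  obtain ⟨x', hx', y', hy', rfl⟩ := mem_cat.1 hw'
  simp only [cfMat_append_apply]
  push_cast
  have key : ∀ k, (cfMat x i k : ℝ) * cfMat y k j ≤
      κ * κ' * (cfMat x' i k * cfMat y' k j) := by
    intro k
    have h1 : (0 : ℝ) ≤ cfMat y k j := by exact_mod_cast cfMat_nonneg (hG1 y hy) k j
    have h2 : (0 : ℝ) ≤ cfMat x' i k := by exact_mod_cast cfMat_nonneg (hF1 x' hx') i k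
    calc (cfMat x i k : ℝ) * cfMat y k j ≤ (κ * cfMat x' i k) * (κ' * cfMat y' k j) :=
          mul_le_mul (hF x hx x' hx' i k) (hG y hy y' hy' k j) h1 (mul_nonneg hκ h2)
      _ = _ := by ring
  have := key 0
  have := key 1
  linarith

theorem Pinned.mono {κ κ' : ℝ} {F : Finset (List ℕ)} (h : κ ≤ κ') (hF : Pinned κ F)
    (hF1 : ∀ w ∈ F, ∀ d ∈ w, 1 ≤ d) : Pinned κ' F := by
  intro w hw w' hw' i j
  have : (0 : ℝ) ≤ cfMat w' i j := by exact_mod_cast cfMat_nonneg (hF1 w' hw') i j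
  exact (hF w hw w' hw' i j).trans (mul_le_mul_of_nonneg_right h this)

theorem letters_cat {F G : Finset (List ℕ)} {p : ℕ → Prop} (hF : ∀ w ∈ F, ∀ d ∈ w, p d)
    (hG : ∀ w ∈ G, ∀ d ∈ w, p d) : ∀ w ∈ cat F G, ∀ d ∈ w, p d := by
  intro w hw d hd
  obtain ⟨x, hx, y, hy, rfl⟩ := mem_cat.1 hw
  rcases List.mem_append.1 hd with h | h
  exacts [hF x hx d h, hG y hy d h]

/-- A sequence of blocks of words of geometrically growing size. -/
structure IsBlockSeq (A : Finset ℕ) (X : ℕ) (B : ℕ → Finset (List ℕ)) : Prop where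
  uniform : ∀ k, Uniform (B k)
  letters : ∀ k, ∀ w ∈ B k, ∀ d ∈ w, d ∈ A
  pinned : ∀ k, Pinned (1 + (1 / 2) ^ (k + 1)) (B k)
  le_cfDen : ∀ k, ∀ w ∈ B k, (X : ℤ) ^ (k + 1) ≤ cfDen w
  cfDen_le : ∀ k, ∀ w ∈ B k, 2 * cfDen w ≤ (X : ℤ) ^ (k + 2)
  card : ∀ k, (X : ℝ) ^ (46 * (k + 1)) ≤ ((B k).card : ℝ) ^ 25

/-- Concatenation of the blocks with indices from a list. -/
def blockCat (B : ℕ → Finset (List ℕ)) : List ℕ → Finset (List ℕ)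
  | [] => {[]}
  | k :: s => cat (B k) (blockCat B s)

theorem blockCat_append (B : ℕ → Finset (List ℕ)) (s s' : List ℕ) :
    blockCat B (s ++ s') = cat (blockCat B s) (blockCat B s') := by
  induction s with
  | nil => simp [blockCat, nil_cat]
  | cons k s ih => simp [blockCat, ih, cat_assoc]

/-- The pinning constant of a concatenation of blocks. -/
noncomputable def pinConst (s : List ℕ) : ℝ := (s.map fun k => 1 + (1 / 2 : ℝ) ^ (k + 1)).prod

theorem one_le_pinConst (s : List ℕ) : 1 ≤ pinConst s := by
  induction s with
  | nil => simp [pinConst]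
  | cons k s ih =>
    simp only [pinConst, List.map_cons, List.prod_cons] at ih ⊢
    have : (0 : ℝ) < (1 / 2) ^ (k + 1) := by positivity
    nlinarith

theorem pinConst_range_le (n : ℕ) : pinConst (List.range n) ≤ 3 := by
  have h : pinConst (List.range n) ≤ Real.exp (1 - (1 / 2) ^ n) := by
    induction n with
    | zero => simp [pinConst]
    | succ n ih =>
      simp only [pinConst, List.range_succ, List.map_append, List.prod_append, List.map_cons,
        List.map_nil, List.prod_cons, List.prod_nil, mul_one] at ih ⊢
      have h1 : (1 : ℝ) + (1 / 2) ^ (n + 1) ≤ Real.exp ((1 / 2) ^ (n + 1)) := by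
        have := Real.add_one_le_exp ((1 / 2 : ℝ) ^ (n + 1)); linarith
      calc _ ≤ Real.exp (1 - (1 / 2) ^ n) * Real.exp ((1 / 2) ^ (n + 1)) := by
            gcongr
        _ = _ := by rw [← Real.exp_add]; congr 1; ring
  refine h.trans ((Real.exp_le_exp.2 (by simp : (1 : ℝ) - (1 / 2) ^ n ≤ 1)).trans ?_)
  linarith [Real.exp_one_lt_d9]

theorem pinConst_append (s s' : List ℕ) : pinConst (s ++ s') = pinConst s * pinConst s' := by
  simp [pinConst]

theorem pinConst_reverse (s : List ℕ) : pinConst s.reverse = pinConst s := by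
  simp [pinConst, List.prod_reverse]

namespace IsBlockSeq

variable {A : Finset ℕ} {X : ℕ} {B : ℕ → Finset (List ℕ)}

theorem uniform_blockCat (h : IsBlockSeq A X B) (s : List ℕ) : Uniform (blockCat B s) := by
  induction s with
  | nil => exact uniform_singleton []
  | cons k s ih => exact (h.uniform k).cat ih

theorem letters_blockCat (h : IsBlockSeq A X B) (s : List ℕ) :
    ∀ w ∈ blockCat B s, ∀ d ∈ w, d ∈ A := by
  induction s with
  | nil => simp [blockCat]
  | cons k s ih => exact letters_cat (h.letters k) ih

theorem pos_of_mem (hA : 0 ∉ A) {w : List ℕ} (h : ∀ d ∈ w, d ∈ A) : ∀ d ∈ w, 1 ≤ d := by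
  intro d hd
  rcases Nat.eq_zero_or_pos d with rfl | h'
  exacts [absurd (h 0 hd) hA, h']

theorem pinned_blockCat (h : IsBlockSeq A X B) (hA : 0 ∉ A) (s : List ℕ) :
    Pinned (pinConst s) (blockCat B s) := by
  induction s with
  | nil => simpa [pinConst, blockCat] using pinned_singleton []
  | cons k s ih =>
    simpa [pinConst, blockCat] using Pinned.cat (by positivity) (h.pinned k) ih
      (fun w hw => pos_of_mem hA (h.letters k w hw))
      (fun w hw => pos_of_mem hA (h.letters_blockCat s w hw))

theorem le_cfDen_blockCat (h : IsBlockSeq A X B) (hA : 0 ∉ A) (s : List ℕ) :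
    ∀ w ∈ blockCat B s, (X : ℤ) ^ (s.map (· + 1)).sum ≤ cfDen w := by
  induction s with
  | nil => simp [blockCat, cfDen, cfMat]
  | cons k s ih =>
    intro w hw
    obtain ⟨x, hx, y, hy, rfl⟩ := mem_cat.1 hw
    have hx1 := pos_of_mem hA (h.letters k x hx)
    refine le_trans ?_ (cfDen_mul_le hx1
      (pos_of_mem hA (h.letters_blockCat s y hy)))
    rw [List.map_cons, List.sum_cons, pow_add]
    exact mul_le_mul (h.le_cfDen k x hx) (ih y hy) (by positivity)
      (zero_le_one.trans (one_le_cfDen hx1))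

theorem cfDen_blockCat_le (h : IsBlockSeq A X B) (hA : 0 ∉ A) (s : List ℕ) :
    ∀ w ∈ blockCat B s, cfDen w ≤ (X : ℤ) ^ (s.map (· + 2)).sum := by
  induction s with
  | nil => simp [blockCat, cfDen, cfMat]
  | cons k s ih =>
    intro w hw
    obtain ⟨x, hx, y, hy, rfl⟩ := mem_cat.1 hw
    have hy1 := pos_of_mem hA (h.letters_blockCat s y hy)
    refine (cfDen_append_le (pos_of_mem hA (h.letters k x hx)) hy1).trans ?_
    rw [List.map_cons, List.sum_cons, pow_add, ← mul_assoc]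
    exact mul_le_mul (h.cfDen_le k x hx) (ih y hy)
      (zero_le_one.trans (one_le_cfDen hy1)) (by positivity)

theorem card_blockCat (h : IsBlockSeq A X B) (s : List ℕ) :
    (X : ℝ) ^ (46 * (s.map (· + 1)).sum) ≤ ((blockCat B s).card : ℝ) ^ 25 := by
  induction s with
  | nil => simp [blockCat]
  | cons k s ih =>
    rw [blockCat, card_cat (h.uniform k), List.map_cons, List.sum_cons, mul_add, pow_add]
    push_cast
    rw [mul_pow]
    exact mul_le_mul (h.card k) ih (by positivity) (by positivity)

theorem nonempty_blockCat (h : IsBlockSeq A X B) (hX : 0 < X) (s : List ℕ) :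
    (blockCat B s).Nonempty := by
  rw [← Finset.card_pos, ← Nat.cast_pos (α := ℝ)]
  have h1 := h.card_blockCat s
  by_contra h2
  have h3 : ((blockCat B s).card : ℝ) = 0 := le_antisymm (not_lt.1 h2) (by positivity)
  rw [h3] at h1
  have : (0 : ℝ) < (X : ℝ) ^ (46 * (s.map (· + 1)).sum) := by positivity
  rw [zero_pow (by norm_num)] at h1
  linarith

end IsBlockSeq

theorem two_mul_sum_range_add_one (n : ℕ) :
    2 * ((List.range n).map (· + 1)).sum = n * (n + 1) := by
  induction n with
  | zero => simp
  | succ n ih =>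
    simp only [List.range_succ, List.map_append, List.sum_append, mul_add, ih]
    simp; ring

theorem two_mul_sum_range_add_two (n : ℕ) :
    2 * ((List.range n).map (· + 2)).sum = n * (n + 3) := by
  induction n with
  | zero => simp
  | succ n ih =>
    simp only [List.range_succ, List.map_append, List.sum_append, mul_add, ih]
    simp; ring

/-! ### A two-dimensional large sieve inequality over `ZMod P` -/

open ZMod in
theorem sum_norm_sq_sum_stdAddChar {P : ℕ} [NeZero P] (f : ZMod P → ℂ) :
    ∑ v : ZMod P, ‖∑ z, f z * stdAddChar (z * v)‖ ^ 2 = P * ∑ z, ‖f z‖ ^ 2 := by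
  have h : ∀ w : ℂ, ((‖w‖ ^ 2 : ℝ) : ℂ) = w * starRingEnd ℂ w := fun w => by
    rw [Complex.mul_conj, Complex.normSq_eq_norm_sq]
  apply Complex.ofReal_injective
  push_cast [← Complex.ofReal_pow]
  simp only [h, map_sum, map_mul, Finset.sum_mul_sum, ← AddChar.map_neg_eq_conj]
  have e : ∀ v x y : ZMod P, f x * stdAddChar (x * v) * (starRingEnd ℂ (f y) *
      stdAddChar (-(y * v))) = f x * starRingEnd ℂ (f y) * stdAddChar (v * (x - y)) := by
    intro v x y
    rw [show v * (x - y) = x * v + -(y * v) by ring, AddChar.map_add_eq_mul]; ring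
  simp only [e]
  rw [Finset.sum_comm]
  simp only [Finset.mul_sum]
  refine Finset.sum_congr rfl fun x _ => ?_
  rw [Finset.sum_comm]
  simp only [← Finset.mul_sum, AddChar.sum_mulShift _ (isPrimitive_stdAddChar P), ZMod.card,
    sub_eq_zero]
  simp [mul_comm]

open ZMod in
theorem sum_norm_sq_sum_stdAddChar_prod {P : ℕ} [NeZero P] (f : ZMod P → ZMod P → ℂ) :
    ∑ v₁ : ZMod P, ∑ v₂ : ZMod P, ‖∑ z₁, ∑ z₂, f z₁ z₂ * stdAddChar (z₁ * v₁ + z₂ * v₂)‖ ^ 2 =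
      P ^ 2 * ∑ z₁, ∑ z₂, ‖f z₁ z₂‖ ^ 2 := by
  have h1 : ∀ v₁ v₂ : ZMod P, ∑ z₁, ∑ z₂, f z₁ z₂ * stdAddChar (z₁ * v₁ + z₂ * v₂) =
      ∑ z₂, (∑ z₁, f z₁ z₂ * stdAddChar (z₁ * v₁)) * stdAddChar (z₂ * v₂) := by
    intro v₁ v₂
    rw [Finset.sum_comm]
    refine Finset.sum_congr rfl fun z₂ _ => ?_
    rw [Finset.sum_mul]
    refine Finset.sum_congr rfl fun z₁ _ => ?_
    rw [AddChar.map_add_eq_mul, mul_assoc]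
  simp only [h1, sum_norm_sq_sum_stdAddChar, ← Finset.mul_sum]
  rw [Finset.sum_comm]
  simp only [sum_norm_sq_sum_stdAddChar, ← Finset.mul_sum]
  rw [Finset.sum_comm (f := fun z₁ z₂ => ‖f z₁ z₂‖ ^ 2)]
  ring

open ZMod in
theorem le_norm_sq_sum_stdAddChar {P : ℕ} [NeZero P] {B L : ℕ} (h : 8 * (L * B) ≤ P)
    {v : ℤ} (hv : 0 ≤ v) (hvL : v ≤ L) :
    (B : ℝ) ^ 2 / 2 ≤
      ‖∑ y ∈ Finset.range B, (stdAddChar ((y : ZMod P) * (v : ZMod P)) : ℂ)‖ ^ 2 := by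
  have hP : (0 : ℝ) < P := by exact_mod_cast NeZero.pos P
  have h1 : ∀ y ∈ Finset.range B,
      √2 / 2 ≤ (stdAddChar ((y : ZMod P) * (v : ZMod P)) : ℂ).re := by
    intro y hy
    have e : ((y : ZMod P) * (v : ZMod P)) = (((y : ℤ) * v : ℤ) : ZMod P) := by push_cast; rfl
    have e2 : (2 * (Real.pi : ℂ) * Complex.I * ((y * v : ℤ) : ℂ) / P) =
        ((2 * Real.pi * (y * v) / P : ℝ) : ℂ) * Complex.I := by push_cast; ring
    rw [e, stdAddChar_coe, e2, Complex.exp_ofReal_mul_I_re, ← Real.cos_pi_div_four]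
    have hy' : (y : ℝ) ≤ B := by exact_mod_cast (Finset.mem_range.1 hy).le
    have hv0 : (0 : ℝ) ≤ v := by exact_mod_cast hv
    have hvL' : (v : ℝ) ≤ L := by exact_mod_cast hvL
    have h8 : 8 * ((L : ℝ) * B) ≤ P := by exact_mod_cast h
    have hyv : (y : ℝ) * v ≤ B * L := by gcongr
    refine Real.cos_le_cos_of_nonneg_of_le_pi (by positivity) (by linarith [Real.pi_pos]) ?_
    rw [div_le_iff₀ hP]
    nlinarith [Real.pi_pos]
  have h2 : (B : ℝ) * (√2 / 2) ≤
      ‖∑ y ∈ Finset.range B, (stdAddChar ((y : ZMod P) * (v : ZMod P)) : ℂ)‖ := by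
    refine le_trans ?_ (Complex.re_le_norm _)
    rw [Complex.re_sum]
    simpa using Finset.card_nsmul_le_sum _ _ _ h1
  calc (B : ℝ) ^ 2 / 2 = (B * (√2 / 2)) ^ 2 := by
        rw [mul_pow, div_pow, Real.sq_sqrt (by norm_num)]; ring
    _ ≤ _ := by gcongr

theorem sum_ite_sub_val_lt {P : ℕ} [NeZero P] {B : ℕ} (hB : B ≤ P) (x : ZMod P)
    {E : Type*} [AddCommMonoid E] (g : ZMod P → E) :
    ∑ z : ZMod P, (if (z - x).val < B then g z else 0) =
      ∑ y ∈ Finset.range B, g (x + (y : ZMod P)) := by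
  rw [← Finset.sum_filter]
  refine Finset.sum_nbij' (fun z => (z - x).val) (fun y => x + (y : ZMod P)) ?_ ?_ ?_ ?_ ?_
  · intro z hz; simpa using hz
  · intro y hy
    have : y < P := (Finset.mem_range.1 hy).trans_le hB
    simpa [ZMod.val_natCast_of_lt this] using hy
  · intro z _; simp
  · intro y hy
    have : y < P := (Finset.mem_range.1 hy).trans_le hB
    simp [ZMod.val_natCast_of_lt this]
  · intro z _; simp

open ZMod in
/-- The dual form of the large sieve inequality. -/
theorem dual_large_sieve {P : ℕ} [NeZero P] {ι κ : Type*} (I : Finset ι) (V : Finset κ)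
    (x₁ x₂ : ι → ZMod P) (v₁ v₂ : κ → ℤ) {L B D : ℕ} (hBL : 8 * (L * B) ≤ P)
    (hPB : P ≤ 16 * (L * B)) (hv₁ : ∀ k ∈ V, 0 ≤ v₁ k ∧ v₁ k ≤ L)
    (hv₂ : ∀ k ∈ V, 0 ≤ v₂ k ∧ v₂ k ≤ L)
    (hinj : ∀ k ∈ V, ∀ l ∈ V, v₁ k = v₁ l → v₂ k = v₂ l → k = l)
    (hD : ∀ z₁ z₂ : ZMod P,
      (I.filter fun i => (z₁ - x₁ i).val < B ∧ (z₂ - x₂ i).val < B).card ≤ D) (c : ι → ℂ) :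
    ∑ k ∈ V, ‖∑ i ∈ I, c i * stdAddChar (x₁ i * (v₁ k : ZMod P) + x₂ i * (v₂ k : ZMod P))‖ ^ 2 ≤
      1024 * D * L ^ 2 * ∑ i ∈ I, ‖c i‖ ^ 2 := by
  have hP0 : 0 < P := NeZero.pos P
  have hLB : 0 < L * B := by omega
  have hL0 : 0 < L := Nat.pos_of_mul_pos_right hLB
  have hB0 : 0 < B := Nat.pos_of_mul_pos_left hLB
  have hBP : B ≤ P := by nlinarith
  have hLP : L < P := by nlinarith
  set f : ZMod P → ZMod P → ℂ := fun z₁ z₂ =>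
    ∑ i ∈ I, if (z₁ - x₁ i).val < B ∧ (z₂ - x₂ i).val < B then c i else 0 with hf
  set G : ZMod P → ZMod P → ℂ := fun w₁ w₂ =>
    ∑ i ∈ I, c i * stdAddChar (x₁ i * w₁ + x₂ i * w₂) with hG
  set E : ZMod P → ℂ := fun w => ∑ y ∈ Finset.range B, stdAddChar ((y : ZMod P) * w) with hE
  have fourier : ∀ w₁ w₂, ∑ z₁, ∑ z₂, f z₁ z₂ * stdAddChar (z₁ * w₁ + z₂ * w₂) =
      G w₁ w₂ * (E w₁ * E w₂) := by
    intro w₁ w₂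
    have : ∀ z₁ z₂, f z₁ z₂ * stdAddChar (z₁ * w₁ + z₂ * w₂) =
        ∑ i ∈ I, if (z₁ - x₁ i).val < B then
          (if (z₂ - x₂ i).val < B then c i * stdAddChar (z₁ * w₁ + z₂ * w₂) else 0) else 0 := by
      intro z₁ z₂
      rw [hf, Finset.sum_mul]
      refine Finset.sum_congr rfl fun i _ => ?_
      rw [ite_and]
      split_ifs <;> simp
    simp only [this]
    calc _ = ∑ z₁, ∑ i ∈ I, ∑ z₂, (if (z₁ - x₁ i).val < B then
          (if (z₂ - x₂ i).val < B then c i * stdAddChar (z₁ * w₁ + z₂ * w₂) else 0) else 0) :=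
          Finset.sum_congr rfl fun z₁ _ => Finset.sum_comm
      _ = ∑ i ∈ I, ∑ z₁, ∑ z₂, (if (z₁ - x₁ i).val < B then
          (if (z₂ - x₂ i).val < B then c i * stdAddChar (z₁ * w₁ + z₂ * w₂) else 0) else 0) :=
          Finset.sum_comm
      _ = _ := ?_
    rw [hG, Finset.sum_mul]
    refine Finset.sum_congr rfl fun i _ => ?_
    have h3 : ∀ z₁, ∑ z₂, (if (z₁ - x₁ i).val < B then
          (if (z₂ - x₂ i).val < B then c i * stdAddChar (z₁ * w₁ + z₂ * w₂) else 0) else 0) =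
        if (z₁ - x₁ i).val < B then ∑ y ∈ Finset.range B,
          c i * stdAddChar (z₁ * w₁ + (x₂ i + (y : ZMod P)) * w₂) else 0 := by
      intro z₁
      split_ifs
      · exact sum_ite_sub_val_lt hBP (x₂ i) fun z₂ => c i * stdAddChar (z₁ * w₁ + z₂ * w₂)
      · simp
    simp only [h3]
    rw [sum_ite_sub_val_lt hBP (x₁ i) fun z₁ => ∑ y ∈ Finset.range B,
          c i * (stdAddChar (z₁ * w₁ + (x₂ i + (y : ZMod P)) * w₂) : ℂ)]
    rw [hE, Finset.sum_mul_sum, Finset.mul_sum]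
    refine Finset.sum_congr rfl fun y _ => ?_
    rw [Finset.mul_sum]
    refine Finset.sum_congr rfl fun y' _ => ?_
    rw [show (x₁ i + (y : ZMod P)) * w₁ + (x₂ i + (y' : ZMod P)) * w₂ =
      (x₁ i * w₁ + x₂ i * w₂) + (y * w₁ + y' * w₂) by ring]
    simp only [AddChar.map_add_eq_mul]
    ring
  have parseval := sum_norm_sq_sum_stdAddChar_prod f
  simp only [fourier] at parseval
  have hfle : ∑ z₁, ∑ z₂, ‖f z₁ z₂‖ ^ 2 ≤ D * B ^ 2 * ∑ i ∈ I, ‖c i‖ ^ 2 := by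
    have h1 : ∀ z₁ z₂, ‖f z₁ z₂‖ ^ 2 ≤ D * ∑ i ∈ I, if (z₁ - x₁ i).val < B then
        (if (z₂ - x₂ i).val < B then ‖c i‖ ^ 2 else 0) else 0 := by
      intro z₁ z₂
      simp only [← ite_and]
      rw [hf]
      simp only [← Finset.sum_filter]
      calc _ ≤ (∑ i ∈ I.filter fun i => (z₁ - x₁ i).val < B ∧ (z₂ - x₂ i).val < B, ‖c i‖) ^ 2 := by
            gcongr; exact norm_sum_le _ _
        _ ≤ _ := sq_sum_le_card_mul_sum_sq
        _ ≤ _ := by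
            gcongr
            exact hD z₁ z₂
    calc _ ≤ ∑ z₁, ∑ z₂, (D * ∑ i ∈ I, if (z₁ - x₁ i).val < B then
        (if (z₂ - x₂ i).val < B then ‖c i‖ ^ 2 else 0) else 0) :=
          Finset.sum_le_sum fun z₁ _ => Finset.sum_le_sum fun z₂ _ => h1 z₁ z₂
      _ = D * ∑ i ∈ I, ∑ z₁, ∑ z₂, (if (z₁ - x₁ i).val < B then
        (if (z₂ - x₂ i).val < B then ‖c i‖ ^ 2 else 0) else 0) := by
          simp only [← Finset.mul_sum]
          congr 1
          rw [Finset.sum_comm]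
          simp only [Finset.sum_comm (s := I)]
          rw [Finset.sum_comm]
      _ = _ := by
          rw [mul_assoc, Finset.mul_sum I _ ((B : ℝ) ^ 2)]
          congr 1
          refine Finset.sum_congr rfl fun i _ => ?_
          have h3 : ∀ z₁, ∑ z₂, (if (z₁ - x₁ i).val < B then
              (if (z₂ - x₂ i).val < B then ‖c i‖ ^ 2 else 0) else 0) =
              if (z₁ - x₁ i).val < B then (B : ℝ) * ‖c i‖ ^ 2 else 0 := by
            intro z₁
            split_ifs
            · rw [sum_ite_sub_val_lt hBP (x₂ i) fun _ => ‖c i‖ ^ 2]; simp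
            · simp
          simp only [h3]
          rw [sum_ite_sub_val_lt hBP (x₁ i) fun _ => (B : ℝ) * ‖c i‖ ^ 2]
          simp; ring
  have lower : ∑ k ∈ V, ‖G (v₁ k) (v₂ k)‖ ^ 2 * ((B : ℝ) ^ 2 / 2 * (B ^ 2 / 2)) ≤
      ∑ w₁, ∑ w₂, ‖G w₁ w₂ * (E w₁ * E w₂)‖ ^ 2 := by
    have h1 : ∀ k ∈ V, ‖G (v₁ k) (v₂ k)‖ ^ 2 * ((B : ℝ) ^ 2 / 2 * (B ^ 2 / 2)) ≤
        ‖G (v₁ k) (v₂ k) * (E (v₁ k) * E (v₂ k))‖ ^ 2 := by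
      intro k hk
      rw [norm_mul, norm_mul, mul_pow, mul_pow]
      gcongr
      · exact le_norm_sq_sum_stdAddChar hBL (hv₁ k hk).1 (hv₁ k hk).2
      · exact le_norm_sq_sum_stdAddChar hBL (hv₂ k hk).1 (hv₂ k hk).2
    refine (Finset.sum_le_sum h1).trans ?_
    rw [← Finset.sum_product']
    have hinjZ : ∀ a b : ℤ, 0 ≤ a → a ≤ L → 0 ≤ b → b ≤ L → (a : ZMod P) = b → a = b := by
      intro a b ha haL hb hbL hab
      rw [ZMod.intCast_eq_intCast_iff] at hab
      refine (Int.emod_eq_of_lt ha (by omega)).symm.trans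
        (Eq.trans hab (Int.emod_eq_of_lt hb (by omega)))
    have hinj2 : Set.InjOn (fun k => ((v₁ k : ZMod P), (v₂ k : ZMod P))) V := by
      intro k hk l hl hkl
      simp only [Prod.mk.injEq] at hkl
      exact hinj k hk l hl
        (hinjZ _ _ (hv₁ k hk).1 (hv₁ k hk).2 (hv₁ l hl).1 (hv₁ l hl).2 hkl.1)
        (hinjZ _ _ (hv₂ k hk).1 (hv₂ k hk).2 (hv₂ l hl).1 (hv₂ l hl).2 hkl.2)
    classical
    rw [← Finset.sum_image (g := fun k => ((v₁ k : ZMod P), (v₂ k : ZMod P)))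
      (f := fun w : ZMod P × ZMod P => ‖G w.1 w.2 * (E w.1 * E w.2)‖ ^ 2) hinj2]
    exact Finset.sum_le_sum_of_subset_of_nonneg (by intro; simp) fun _ _ _ => by positivity
  rw [parseval, ← Finset.sum_mul] at lower
  have hBr : (0 : ℝ) < B := by exact_mod_cast hB0
  have hPB' : (P : ℝ) ≤ 16 * (L * B) := by exact_mod_cast hPB
  have hN : 0 ≤ ∑ i ∈ I, ‖c i‖ ^ 2 := Finset.sum_nonneg fun _ _ => by positivity
  have h5 : (∑ k ∈ V, ‖G (v₁ k) (v₂ k)‖ ^ 2) * ((B : ℝ) ^ 2 / 2 * (B ^ 2 / 2)) ≤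
      (1024 * D * L ^ 2 * ∑ i ∈ I, ‖c i‖ ^ 2) * ((B : ℝ) ^ 2 / 2 * (B ^ 2 / 2)) := by
    calc _ ≤ _ := lower
      _ ≤ (16 * (L * B)) ^ 2 * (D * B ^ 2 * ∑ i ∈ I, ‖c i‖ ^ 2) := by gcongr
      _ = _ := by ring
  exact le_of_mul_le_mul_right h5 (by positivity)

open ZMod in
theorem large_sieve {P : ℕ} [NeZero P] {ι κ : Type*} (I : Finset ι) (V : Finset κ)
    (x₁ x₂ : ι → ZMod P) (v₁ v₂ : κ → ℤ) {L B D : ℕ} (hBL : 8 * (L * B) ≤ P)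
    (hPB : P ≤ 16 * (L * B)) (hv₁ : ∀ k ∈ V, 0 ≤ v₁ k ∧ v₁ k ≤ L)
    (hv₂ : ∀ k ∈ V, 0 ≤ v₂ k ∧ v₂ k ≤ L)
    (hinj : ∀ k ∈ V, ∀ l ∈ V, v₁ k = v₁ l → v₂ k = v₂ l → k = l)
    (hD : ∀ z₁ z₂ : ZMod P,
      (I.filter fun i => (z₁ - x₁ i).val < B ∧ (z₂ - x₂ i).val < B).card ≤ D) :
    ∑ i ∈ I, ‖∑ k ∈ V, (stdAddChar (x₁ i * (v₁ k : ZMod P) + x₂ i * (v₂ k : ZMod P)) : ℂ)‖ ^ 2 ≤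
      1024 * D * L ^ 2 * V.card := by
  set T : ι → ℂ := fun i =>
    ∑ k ∈ V, (stdAddChar (x₁ i * (v₁ k : ZMod P) + x₂ i * (v₂ k : ZMod P)) : ℂ) with hT
  have dual := dual_large_sieve I V x₁ x₂ v₁ v₂ hBL hPB hv₁ hv₂ hinj hD
    fun i => starRingEnd ℂ (T i)
  simp only [RCLike.norm_conj] at dual
  set N := ∑ i ∈ I, ‖T i‖ ^ 2 with hN
  have hN0 : 0 ≤ N := Finset.sum_nonneg fun _ _ => by positivity
  have h1 : N = ‖∑ k ∈ V, ∑ i ∈ I, starRingEnd ℂ (T i) *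
      stdAddChar (x₁ i * (v₁ k : ZMod P) + x₂ i * (v₂ k : ZMod P))‖ := by
    rw [Finset.sum_comm]
    simp only [← Finset.mul_sum]
    have : ∀ i ∈ I, starRingEnd ℂ (T i) * ∑ k ∈ V,
        (stdAddChar (x₁ i * (v₁ k : ZMod P) + x₂ i * (v₂ k : ZMod P)) : ℂ) =
        ((‖T i‖ ^ 2 : ℝ) : ℂ) := fun i _ => by
      rw [← Complex.normSq_eq_norm_sq, ← Complex.mul_conj, mul_comm]
    rw [Finset.sum_congr rfl this, ← Complex.ofReal_sum, Complex.norm_real,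
      Real.norm_of_nonneg hN0]
  have h2 : N ^ 2 ≤ V.card * (1024 * D * L ^ 2 * N) := by
    calc N ^ 2 ≤ (∑ k ∈ V, ‖∑ i ∈ I, starRingEnd ℂ (T i) *
          stdAddChar (x₁ i * (v₁ k : ZMod P) + x₂ i * (v₂ k : ZMod P))‖) ^ 2 := by
          gcongr
          rw [h1]
          exact norm_sum_le _ _
      _ ≤ _ := sq_sum_le_card_mul_sum_sq
      _ ≤ _ := by gcongr
  rcases hN0.eq_or_lt with h0 | h0
  · rw [← h0]; positivity
  · nlinarith

/-! ### Separation of the points `b • u` modulo `P` -/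

section separation

variable {P B M Z b b' u₁ u₂ u₁' u₂' ε₁ ε₂ m₁ m₂ q q' a a' r r' : ℤ}

theorem abs_mul_sub_mul_le (hε₁ : |ε₁| ≤ B) (hε₂ : |ε₂| ≤ B) (h₁ : |u₁'| ≤ M) (h₂ : |u₂'| ≤ M) :
    |ε₁ * u₂' - ε₂ * u₁'| ≤ 2 * (B * M) := by
  have hB : 0 ≤ B := (abs_nonneg _).trans hε₁
  have k1 : |ε₁ * u₂'| ≤ B * M := by
    rw [abs_mul]; exact mul_le_mul hε₁ h₂ (abs_nonneg _) hB
  have k2 : |ε₂ * u₁'| ≤ B * M := by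
    rw [abs_mul]; exact mul_le_mul hε₂ h₁ (abs_nonneg _) hB
  linarith [abs_sub (ε₁ * u₂') (ε₂ * u₁')]

theorem exists_abs_mul_wedge_sub_le (hε₁ : |ε₁| ≤ B) (hε₂ : |ε₂| ≤ B) (h₁ : |u₁'| ≤ M)
    (h₂ : |u₂'| ≤ M) (e₁ : b * u₁ - b' * u₁' = ε₁ + P * m₁)
    (e₂ : b * u₂ - b' * u₂' = ε₂ + P * m₂) :
    ∃ m, |b * (u₁ * u₂' - u₂ * u₁') - P * m| ≤ 2 * (B * M) := by
  refine ⟨m₁ * u₂' - m₂ * u₁', ?_⟩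
  rw [show b * (u₁ * u₂' - u₂ * u₁') - P * (m₁ * u₂' - m₂ * u₁') = ε₁ * u₂' - ε₂ * u₁' by
    linear_combination u₂' * e₁ - u₁' * e₂]
  exact abs_mul_sub_mul_le hε₁ hε₂ h₁ h₂

theorem major_aux (hq : 1 ≤ q) (hqZ : q ≤ Z) (hq' : 1 ≤ q') (hqZ' : q' ≤ Z)
    (hr : |r| ≤ Z * q) (hr' : |r'| ≤ Z * q') (er : b * q = a * P + r)
    (er' : b' * q' = a' * P + r') (h : Z ^ 2 * B + 2 * (Z ^ 3 * M) < P) (hε₁ : |ε₁| ≤ B)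
    (h₁ : |u₁| ≤ M) (h₁' : |u₁'| ≤ M) (e₁ : b * u₁ - b' * u₁' = ε₁ + P * m₁) :
    q' * (a * u₁) - q * (a' * u₁') = q * q' * m₁ ∧
      q * q' * ε₁ = q' * (r * u₁) - q * (r' * u₁') := by
  have key : P * (q' * (a * u₁) - q * (a' * u₁') - q * q' * m₁) =
      q * q' * ε₁ - q' * (r * u₁) + q * (r' * u₁') := by
    linear_combination q * q' * e₁ - q' * u₁ * er + q * u₁' * er'
  have hM : 0 ≤ M := (abs_nonneg _).trans h₁
  have hB : 0 ≤ B := (abs_nonneg _).trans hε₁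
  have hZ : 1 ≤ Z := hq.trans hqZ
  have k1 : |q * q' * ε₁| ≤ Z ^ 2 * B := by
    rw [abs_mul, abs_mul, abs_of_nonneg (by linarith : 0 ≤ q), abs_of_nonneg (by linarith : 0 ≤ q')]
    calc q * q' * |ε₁| ≤ Z * Z * B := by gcongr
      _ = _ := by ring
  have k2 : |q' * (r * u₁)| ≤ Z ^ 3 * M := by
    rw [abs_mul, abs_mul, abs_of_nonneg (by linarith : 0 ≤ q')]
    calc q' * (|r| * |u₁|) ≤ Z * ((Z * Z) * M) := by
          have : |r| ≤ Z * Z := hr.trans (by gcongr)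
          gcongr
      _ = _ := by ring
  have k3 : |q * (r' * u₁')| ≤ Z ^ 3 * M := by
    rw [abs_mul, abs_mul, abs_of_nonneg (by linarith : 0 ≤ q)]
    calc q * (|r'| * |u₁'|) ≤ Z * ((Z * Z) * M) := by
          have : |r'| ≤ Z * Z := hr'.trans (by gcongr)
          gcongr
      _ = _ := by ring
  have hZ2 : 0 ≤ Z ^ 2 * B := by positivity
  have hZ3 : 0 ≤ Z ^ 3 * M := by positivity
  have h0 : q' * (a * u₁) - q * (a' * u₁') - q * q' * m₁ = 0 := by
    by_contra hne
    have h1 : 1 ≤ |q' * (a * u₁) - q * (a' * u₁') - q * q' * m₁| := Int.one_le_abs hne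
    have h2 : P * |q' * (a * u₁) - q * (a' * u₁') - q * q' * m₁| ≤ Z ^ 2 * B + 2 * (Z ^ 3 * M) := by
      rw [← abs_of_nonneg (by linarith : 0 ≤ P), ← abs_mul, key]
      linarith [abs_add_le (q * q' * ε₁ - q' * (r * u₁)) (q * (r' * u₁')),
        abs_sub (q * q' * ε₁) (q' * (r * u₁))]
    nlinarith
  rw [h0, mul_zero] at key
  constructor <;> linarith

theorem dvd_of_dvd_mul_row {x q : ℤ} (hu : IsCoprime u₁ u₂) (h₁ : q ∣ x * u₁) (h₂ : q ∣ x * u₂) :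
    q ∣ x := by
  obtain ⟨s, t, hst⟩ := hu
  have := dvd_add (h₁.mul_left s) (h₂.mul_left t)
  rwa [show s * (x * u₁) + t * (x * u₂) = x by linear_combination x * hst] at this

/-- On major arcs, close points have the same denominator. -/
theorem major_arcs (hq : 1 ≤ q) (hqZ : q ≤ Z) (hq' : 1 ≤ q') (hqZ' : q' ≤ Z)
    (hr : |r| ≤ Z * q) (hr' : |r'| ≤ Z * q') (er : b * q = a * P + r)
    (er' : b' * q' = a' * P + r') (hc : IsCoprime a q) (hc' : IsCoprime a' q')
    (h : Z ^ 2 * B + 2 * (Z ^ 3 * M) < P) (hε₁ : |ε₁| ≤ B) (hε₂ : |ε₂| ≤ B)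
    (h₁ : |u₁| ≤ M) (h₁' : |u₁'| ≤ M) (h₂ : |u₂| ≤ M) (h₂' : |u₂'| ≤ M)
    (hu : IsCoprime u₁ u₂) (hu' : IsCoprime u₁' u₂')
    (e₁ : b * u₁ - b' * u₁' = ε₁ + P * m₁) (e₂ : b * u₂ - b' * u₂' = ε₂ + P * m₂) :
    q = q' ∧ (a * u₁ - a' * u₁' = q * m₁ ∧ a * u₂ - a' * u₂' = q * m₂) ∧
      q * ε₁ = r * u₁ - r' * u₁' ∧ q * ε₂ = r * u₂ - r' * u₂' := by
  obtain ⟨f₁, g₁⟩ := major_aux hq hqZ hq' hqZ' hr hr' er er' h hε₁ h₁ h₁' e₁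
  obtain ⟨f₂, g₂⟩ := major_aux hq hqZ hq' hqZ' hr hr' er er' h hε₂ h₂ h₂' e₂
  have d1 : q ∣ q' := by
    have : q ∣ q' * a := dvd_of_dvd_mul_row hu
      ⟨a' * u₁' + q' * m₁, by linear_combination f₁⟩ ⟨a' * u₂' + q' * m₂, by linear_combination f₂⟩
    exact hc.symm.dvd_of_dvd_mul_right this
  have d2 : q' ∣ q := by
    have : q' ∣ q * a' := dvd_of_dvd_mul_row hu'
      ⟨a * u₁ - q * m₁, by linear_combination -f₁⟩ ⟨a * u₂ - q * m₂, by linear_combination -f₂⟩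
    exact hc'.symm.dvd_of_dvd_mul_right this
  have hqq : q = q' := Int.dvd_antisymm (by linarith) (by linarith) d1 d2
  subst hqq
  have hq0 : q ≠ 0 := by linarith
  refine ⟨rfl, ⟨?_, ?_⟩, ?_, ?_⟩ <;> apply mul_left_cancel₀ hq0 <;> linarith

theorem dvd_wedge (hc : IsCoprime a q) (f₁ : a * u₁ - a' * u₁' = q * m₁)
    (f₂ : a * u₂ - a' * u₂' = q * m₂) : q ∣ u₁ * u₂' - u₂ * u₁' := by
  have : q ∣ a * (u₁ * u₂' - u₂ * u₁') :=
    ⟨m₁ * u₂' - m₂ * u₁', by linear_combination u₂' * f₁ - u₁' * f₂⟩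
  exact hc.symm.dvd_of_dvd_mul_left this

theorem mul_abs_wedge_le {Z' : ℤ} (hq : 1 ≤ q) (hr : Z' * q < |r|) (hε₁ : |ε₁| ≤ B)
    (hε₂ : |ε₂| ≤ B) (h₁' : |u₁'| ≤ M) (h₂' : |u₂'| ≤ M) (g₁ : q * ε₁ = r * u₁ - r' * u₁')
    (g₂ : q * ε₂ = r * u₂ - r' * u₂') : Z' * |u₁ * u₂' - u₂ * u₁'| ≤ 2 * (B * M) := by
  have key : r * (u₁ * u₂' - u₂ * u₁') = q * (ε₁ * u₂' - ε₂ * u₁') := by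
    linear_combination u₁' * g₂ - u₂' * g₁
  have h1 : |r| * |u₁ * u₂' - u₂ * u₁'| ≤ q * (2 * (B * M)) := by
    rw [← abs_mul, key, abs_mul, abs_of_nonneg (by linarith : 0 ≤ q)]
    have := abs_mul_sub_mul_le hε₁ hε₂ h₁' h₂'
    gcongr
  have h2 : Z' * q * |u₁ * u₂' - u₂ * u₁'| ≤ |r| * |u₁ * u₂' - u₂ * u₁'| := by gcongr
  refine le_of_mul_le_mul_left (?_ : q * _ ≤ q * _) (by linarith : 0 < q)
  linarith

theorem major_same_word (hq : 1 ≤ q) (hu : IsCoprime u₁ u₂) (er : b * q = a * P + r)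
    (er' : b' * q = a' * P + r') (f₁ : a * u₁ - a' * u₁ = q * m₁)
    (f₂ : a * u₂ - a' * u₂ = q * m₂) (g₂ : q * ε₂ = r * u₂ - r' * u₂) :
    ∃ k, (b - b' - k * P) * u₂ = ε₂ := by
  obtain ⟨k, hk⟩ : q ∣ a - a' := dvd_of_dvd_mul_row hu ⟨m₁, by linear_combination f₁⟩
    ⟨m₂, by linear_combination f₂⟩
  refine ⟨k, mul_left_cancel₀ (by linarith : q ≠ 0) ?_⟩
  linear_combination -g₂ + u₂ * er - u₂ * er' + u₂ * P * hk

theorem minor_same_word (h : 2 * (B * M) < P) (hu : IsCoprime u₁ u₂) (hε₁ : |ε₁| ≤ B)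
    (hε₂ : |ε₂| ≤ B) (h₁ : |u₁| ≤ M) (h₂ : |u₂| ≤ M)
    (e₁ : b * u₁ - b' * u₁ = ε₁ + P * m₁) (e₂ : b * u₂ - b' * u₂ = ε₂ + P * m₂) :
    ∃ k, (b - b' - k * P) * u₂ = ε₂ := by
  have key : P * (m₁ * u₂ - m₂ * u₁) = -(ε₁ * u₂ - ε₂ * u₁) := by
    linear_combination u₁ * e₂ - u₂ * e₁
  have hle := abs_mul_sub_mul_le hε₁ hε₂ h₁ h₂
  have h0 : m₁ * u₂ - m₂ * u₁ = 0 := by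
    by_contra hne
    have h1 := Int.one_le_abs hne
    have hP : 0 ≤ P := by
      linarith [abs_nonneg (ε₁ * u₂ - ε₂ * u₁)]
    have h2 : P * |m₁ * u₂ - m₂ * u₁| ≤ 2 * (B * M) := by
      rw [← abs_of_nonneg hP, ← abs_mul, key, abs_neg]; exact hle
    nlinarith
  obtain ⟨k, hk⟩ : u₂ ∣ m₂ := hu.symm.dvd_of_dvd_mul_right
    (⟨m₁, by linear_combination -h0⟩ : u₂ ∣ m₂ * u₁)
  exact ⟨k, by linear_combination e₂ + P * hk⟩

end separation

/-- Points separated up to a bounded shift of `b` meet every box boundedly often. -/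
theorem card_box_le {P : ℕ} [NeZero P] {B : ℕ} (Θ : Finset (ZMod P)) (T : Finset (List ℕ))
    (u : List ℕ → List ℕ)
    (hsep : ∀ b ∈ Θ, ∀ b' ∈ Θ, ∀ t ∈ T, ∀ t' ∈ T, ∀ ε₁ ε₂ m₁ m₂ : ℤ, |ε₁| ≤ B → |ε₂| ≤ B →
      (b.val : ℤ) * cfMat (u t) 1 0 - b'.val * cfMat (u t') 1 0 = ε₁ + P * m₁ →
      (b.val : ℤ) * cfMat (u t) 1 1 - b'.val * cfMat (u t') 1 1 = ε₂ + P * m₂ →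
      t = t' ∧ ∃ k : ℤ, |(b.val : ℤ) - b'.val - k * P| ≤ 21) (z₁ z₂ : ZMod P) :
    ((Θ ×ˢ T).filter fun p => (z₁ - p.1 * (cfMat (u p.2) 1 0 : ZMod P)).val < B ∧
      (z₂ - p.1 * (cfMat (u p.2) 1 1 : ZMod P)).val < B).card ≤ 43 := by
  classical
  set S := (Θ ×ˢ T).filter fun p => (z₁ - p.1 * (cfMat (u p.2) 1 0 : ZMod P)).val < B ∧
      (z₂ - p.1 * (cfMat (u p.2) 1 1 : ZMod P)).val < B with hS
  have diff : ∀ (z : ZMod P) (b b' : ZMod P) (x x' : ℤ), (z - b * (x : ZMod P)).val < B →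
      (z - b' * (x' : ZMod P)).val < B → ∃ ε m : ℤ, |ε| ≤ B ∧
        (b.val : ℤ) * x - b'.val * x' = ε + P * m := by
    intro z b b' x x' h h'
    set y := z - b * (x : ZMod P) with hy
    set y' := z - b' * (x' : ZMod P) with hy'
    have hd : (P : ℤ) ∣ (b.val : ℤ) * x - b'.val * x' - (y'.val - y.val) := by
      rw [← ZMod.intCast_zmod_eq_zero_iff_dvd]
      push_cast
      simp only [ZMod.natCast_val, ZMod.cast_id', id]
      rw [hy, hy']; ring
    obtain ⟨m, hm⟩ := hd
    refine ⟨y'.val - y.val, m, ?_, by linarith⟩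
    rw [abs_le]; constructor <;> omega
  rcases S.eq_empty_or_nonempty with h0 | ⟨p', hp'⟩
  · simp [h0]
  · have sub : S ⊆ (Finset.Icc (-21 : ℤ) 21).image fun k : ℤ => (p'.1 + (k : ZMod P), p'.2) := by
      intro p hp
      rw [hS, Finset.mem_filter, Finset.mem_product] at hp hp'
      obtain ⟨ε₁, m₁, hε₁, e₁⟩ := diff z₁ p.1 p'.1 _ _ hp.2.1 hp'.2.1
      obtain ⟨ε₂, m₂, hε₂, e₂⟩ := diff z₂ p.1 p'.1 _ _ hp.2.2 hp'.2.2
      obtain ⟨ht, k, hk⟩ := hsep p.1 hp.1.1 p'.1 hp'.1.1 p.2 hp.1.2 p'.2 hp'.1.2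
        ε₁ ε₂ m₁ m₂ hε₁ hε₂ e₁ e₂
      rw [Finset.mem_image]
      refine ⟨(p.1.val : ℤ) - p'.1.val - k * P, Finset.mem_Icc.2 (abs_le.1 hk), ?_⟩
      refine Prod.ext ?_ ht.symm
      push_cast
      simp
    refine (Finset.card_le_card sub).trans (Finset.card_image_le.trans ?_)
    simp

open ZMod in
/-- Large sieve estimate for a set `Θ` of frequencies on which the rows are separated. -/
theorem sum_norm_sq_le_of_card_box_le {P : ℕ} [NeZero P] {L B D : ℕ} (Θ : Finset (ZMod P))
    (G T V : Finset (List ℕ)) (u : List ℕ → List ℕ → List ℕ) (hBL : 8 * (L * B) ≤ P)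
    (hPB : P ≤ 16 * (L * B)) (hV : Uniform V) (hV1 : ∀ v ∈ V, ∀ d ∈ v, 1 ≤ d)
    (hVL : ∀ v ∈ V, cfDen v ≤ L)
    (hD : ∀ g ∈ G, ∀ z₁ z₂ : ZMod P,
      ((Θ ×ˢ T).filter fun p => (z₁ - p.1 * (cfMat (u g p.2) 1 0 : ZMod P)).val < B ∧
        (z₂ - p.1 * (cfMat (u g p.2) 1 1 : ZMod P)).val < B).card ≤ D) :
    ∑ b ∈ Θ, ‖∑ g ∈ G, ∑ t ∈ T, ∑ v ∈ V, (stdAddChar (b * (cfDen (u g t ++ v) : ZMod P)) : ℂ)‖ ^ 2 ≤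
      1024 * D * L ^ 2 * (G.card ^ 2 * T.card * V.card) := by
  have step : ∀ g ∈ G, ∑ b ∈ Θ, ∑ t ∈ T,
      ‖∑ v ∈ V, (stdAddChar (b * (cfDen (u g t ++ v) : ZMod P)) : ℂ)‖ ^ 2 ≤
      1024 * D * L ^ 2 * V.card := by
    intro g hg
    have := large_sieve (Θ ×ˢ T) V (fun p => p.1 * (cfMat (u g p.2) 1 0 : ZMod P))
      (fun p => p.1 * (cfMat (u g p.2) 1 1 : ZMod P)) (fun v => cfMat v 0 1)
      (fun v => cfMat v 1 1) hBL hPB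
      (fun v hv => ⟨cfMat_nonneg (hV1 v hv) _ _, (cfMat_le_cfDen (hV1 v hv) _ _).trans (hVL v hv)⟩)
      (fun v hv => ⟨cfMat_nonneg (hV1 v hv) _ _, (cfMat_le_cfDen (hV1 v hv) _ _).trans (hVL v hv)⟩)
      (fun v hv v' hv' => eq_of_cfMat_col_eq (hV1 v hv) (hV1 v' hv') (hV v hv v' hv')) (hD g hg)
    rw [Finset.sum_product] at this
    refine le_trans (le_of_eq ?_) this
    refine Finset.sum_congr rfl fun b _ => Finset.sum_congr rfl fun t _ => ?_
    congr 3 with v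
    congr 1
    rw [cfDen_append, cfDen, cfDen]
    push_cast; ring
  calc _ ≤ ∑ b ∈ Θ, ∑ g ∈ G, ∑ t ∈ T, (G.card * T.card : ℝ) *
        ‖∑ v ∈ V, (stdAddChar (b * (cfDen (u g t ++ v) : ZMod P)) : ℂ)‖ ^ 2 := by
        refine Finset.sum_le_sum fun b _ => ?_
        calc _ ≤ (∑ g ∈ G, ‖∑ t ∈ T, ∑ v ∈ V,
              (stdAddChar (b * (cfDen (u g t ++ v) : ZMod P)) : ℂ)‖) ^ 2 := by
              gcongr; exact norm_sum_le _ _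
          _ ≤ G.card * ∑ g ∈ G, ‖∑ t ∈ T, ∑ v ∈ V,
              (stdAddChar (b * (cfDen (u g t ++ v) : ZMod P)) : ℂ)‖ ^ 2 :=
              sq_sum_le_card_mul_sum_sq
          _ ≤ G.card * ∑ g ∈ G, (T.card * ∑ t ∈ T, ‖∑ v ∈ V,
              (stdAddChar (b * (cfDen (u g t ++ v) : ZMod P)) : ℂ)‖ ^ 2) := by
              gcongr with g hg
              refine (pow_le_pow_left₀ (norm_nonneg _) (norm_sum_le _ _) 2).trans ?_
              exact sq_sum_le_card_mul_sum_sq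
          _ = _ := by simp only [Finset.mul_sum, mul_assoc]
    _ = (G.card * T.card) * ∑ g ∈ G, ∑ b ∈ Θ, ∑ t ∈ T,
        ‖∑ v ∈ V, (stdAddChar (b * (cfDen (u g t ++ v) : ZMod P)) : ℂ)‖ ^ 2 := by
        rw [Finset.sum_comm]; simp only [Finset.mul_sum]
    _ ≤ (G.card * T.card) * ∑ g ∈ G, (1024 * D * L ^ 2 * V.card : ℝ) := by
        gcongr with g hg; exact step g hg
    _ = _ := by simp; ring

/-! ### Rational approximation layers -/

/-- `b / P` is close to a rational number with denominator at most `Z`. -/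
def App (P Z : ℕ) (b : ZMod P) : Prop :=
  ∃ q a : ℤ, 1 ≤ q ∧ q ≤ Z ∧ IsCoprime a q ∧ |(b.val : ℤ) * q - a * P| ≤ Z * q

theorem App.of_abs_le {P Z : ℕ} {b : ZMod P} {n m : ℤ} (hn : n ≠ 0) (hnZ : |n| ≤ Z)
    (h : |(b.val : ℤ) * n - P * m| ≤ Z) : App P Z b := by
  wlog hpos : 0 < n generalizing n m
  · refine this (n := -n) (m := -m) (neg_ne_zero.2 hn) (by rwa [abs_neg]) ?_ (by omega)
    rwa [show (b.val : ℤ) * -n - P * -m = -((b.val : ℤ) * n - P * m) by ring, abs_neg]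
  · have hg : 0 < Int.gcd m n := Int.gcd_pos_of_ne_zero_right _ hn
    obtain ⟨a, q, hc, ha, hq⟩ := Int.exists_gcd_one hg
    have hg1 : 1 ≤ ((Int.gcd m n : ℕ) : ℤ) := by exact_mod_cast hg
    generalize ((Int.gcd m n : ℕ) : ℤ) = g at ha hq hg1
    have hq0 : 0 < q := by
      by_contra hq0
      nlinarith
    rw [abs_of_pos hpos] at hnZ
    refine ⟨q, a, hq0, by nlinarith, Int.isCoprime_iff_gcd_eq_one.2 hc, ?_⟩
    have e : (b.val : ℤ) * n - P * m = g * ((b.val : ℤ) * q - a * P) := by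
      rw [hq, ha]; ring
    rw [e, abs_mul, abs_of_pos (by linarith)] at h
    have := abs_nonneg ((b.val : ℤ) * q - a * P)
    have hZ : (0 : ℤ) ≤ Z := by positivity
    nlinarith

/-- Boundedly many `b` are well approximable at a fixed level. -/
theorem card_app_le {P Z : ℕ} [NeZero P] (Θ : Finset (ZMod P)) (h : ∀ b ∈ Θ, App P Z b) :
    Θ.card ≤ (Z + 1) * (2 * (Z * (Z + 1)) + 1) * (2 * (Z * Z) + 1) := by
  classical
  choose! q a h1 h2 _ h4 using h
  have hP : (1 : ℤ) ≤ P := by exact_mod_cast NeZero.pos P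
  have key : Θ.card ≤ (Finset.Icc (0 : ℤ) Z ×ˢ (Finset.Icc (-(Z * (Z + 1) : ℤ)) (Z * (Z + 1)) ×ˢ
      Finset.Icc (-(Z * Z : ℤ)) (Z * Z))).card := by
    refine Finset.card_le_card_of_injOn
      (fun b => (q b, a b, (b.val : ℤ) * q b - a b * P)) ?_ ?_
    · intro b hb
      simp only [Finset.coe_product, Set.mem_prod, Finset.coe_Icc, Set.mem_Icc, ← abs_le]
      have k1 := h1 b hb
      have k2 := h2 b hb
      have k4 := h4 b hb
      have hr : |(b.val : ℤ) * q b - a b * P| ≤ Z * Z := k4.trans (by gcongr)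
      refine ⟨⟨by linarith, k2⟩, ?_, hr⟩
      have hv : (b.val : ℤ) ≤ P := by exact_mod_cast (ZMod.val_lt b).le
      have hv0 : (0 : ℤ) ≤ b.val := by positivity
      have e : |a b| * P ≤ Z * (Z + 1) * P := by
        rw [← abs_of_nonneg (by linarith : (0 : ℤ) ≤ P), ← abs_mul,
          abs_of_nonneg (by linarith : (0 : ℤ) ≤ P)]
        have t1 : |a b * P| ≤ |(b.val : ℤ) * q b| + |(b.val : ℤ) * q b - a b * P| := by
          have := abs_sub ((b.val : ℤ) * q b) ((b.val : ℤ) * q b - a b * P)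
          simpa using this
        have t2 : |(b.val : ℤ) * q b| ≤ P * Z := by
          rw [abs_mul, abs_of_nonneg hv0, abs_of_nonneg (by linarith : 0 ≤ q b)]
          gcongr
        have : (Z * Z : ℤ) ≤ Z * Z * P := by
          have : (0 : ℤ) ≤ Z * Z := by positivity
          nlinarith
        linarith
      exact le_of_mul_le_mul_right e (by linarith)
    · intro b hb b' hb' he
      simp only [Prod.mk.injEq] at he
      obtain ⟨e1, e2, e3⟩ := he
      have k1 := h1 b hb
      rw [← e1, ← e2] at e3
      have : (b.val : ℤ) = b'.val := by
        have : (b.val : ℤ) * q b = b'.val * q b := by linarith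
        exact mul_right_cancel₀ (by linarith : q b ≠ 0) this
      exact ZMod.val_injective P (by exact_mod_cast this)
  refine key.trans (le_of_eq ?_)
  simp only [Finset.card_product, Int.card_Icc]
  rw [mul_assoc]
  congr 1
  congr 1
  · have : (0 : ℤ) ≤ Z * (Z + 1) := by positivity
    zify; rw [Int.toNat_of_nonneg (by linarith)]; ring
  · have : (0 : ℤ) ≤ Z * Z := by positivity
    zify; rw [Int.toNat_of_nonneg (by linarith)]; ring

/-- A splitting of words into a left part `u g t` and a right part, adapted to a modulus `P`. -/
structure IsSplit (P m l : ℕ) (G T V : Finset (List ℕ)) (u : List ℕ → List ℕ → List ℕ) :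
    Prop where
  m_pos : 1 ≤ m
  l_pos : 1 ≤ l
  le_P : 81 * (m * l) ≤ P
  P_le : P ≤ 162 * (m * l)
  u_pos : ∀ g ∈ G, ∀ t ∈ T, ∀ d ∈ u g t, 1 ≤ d
  le_u : ∀ g ∈ G, ∀ t ∈ T, m ≤ 9 * cfDen (u g t)
  u_le : ∀ g ∈ G, ∀ t ∈ T, cfDen (u g t) ≤ 9 * m
  V_unif : Uniform V
  V_pos : ∀ v ∈ V, ∀ d ∈ v, 1 ≤ d
  V_le : ∀ v ∈ V, cfDen v ≤ 9 * l

namespace IsSplit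

variable {P m l : ℕ} {G T V : Finset (List ℕ)} {u : List ℕ → List ℕ → List ℕ}

theorem abs_row_le (h : IsSplit P m l G T V u) {g t : List ℕ} (hg : g ∈ G) (ht : t ∈ T)
    (j : Fin 2) : |cfMat (u g t) 1 j| ≤ 9 * (m : ℤ) := by
  rw [abs_of_nonneg (cfMat_nonneg (h.u_pos g hg t ht) 1 j)]
  exact (cfMat_le_cfDen (h.u_pos g hg t ht) 1 j).trans (h.u_le g hg t ht)

/-- The side length of the boxes. -/
theorem box (h : IsSplit P m l G T V u) :
    8 * ((9 * l) * (P / (8 * (9 * l)))) ≤ P ∧ P ≤ 16 * ((9 * l) * (P / (8 * (9 * l)))) ∧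
      1 ≤ P / (8 * (9 * l)) ∧ 4 * (P / (8 * (9 * l))) ≤ 9 * m := by
  have h1 := h.m_pos
  have h2 := h.l_pos
  have h3 := h.le_P
  have h4 := h.P_le
  have hd := Nat.div_add_mod P (8 * (9 * l))
  have hm := Nat.mod_lt P (by omega : 8 * (9 * l) > 0)
  have h5 : 1 ≤ P / (8 * (9 * l)) := by
    rw [Nat.one_le_div_iff (by omega)]
    nlinarith
  have h0 := Nat.zero_le (P % (8 * (9 * l)))
  set Q := P / (8 * (9 * l))
  have h6 : l ≤ l * Q := Nat.le_mul_of_pos_right _ h5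
  refine ⟨by nlinarith, by nlinarith, h5, ?_⟩
  have : l * (4 * Q) ≤ l * (9 * m) := by nlinarith
  exact Nat.le_of_mul_le_mul_left this h2

theorem abs_le_of_mul (h : IsSplit P m l G T V u) {g t : List ℕ} (hg : g ∈ G) (ht : t ∈ T)
    {x ε : ℤ} (hε : |ε| ≤ (P / (8 * (9 * l)) : ℕ)) (e : x * cfMat (u g t) 1 1 = ε) : |x| ≤ 21 := by
  have h1 : (1 : ℤ) ≤ cfMat (u g t) 1 1 := one_le_cfDen (h.u_pos g hg t ht)
  have h2 : (m : ℤ) ≤ 9 * cfMat (u g t) 1 1 := h.le_u g hg t ht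
  have h3 : (4 * (P / (8 * (9 * l)) : ℕ) : ℤ) ≤ 9 * m := by exact_mod_cast h.box.2.2.2
  rw [← e, abs_mul, abs_of_nonneg (by linarith : 0 ≤ cfMat (u g t) 1 1)] at hε
  nlinarith

open ZMod in
theorem sum_le (h : IsSplit P m l G T V u) [NeZero P] (Θ : Finset (ZMod P))
    (hsep : ∀ g ∈ G, ∀ b ∈ Θ, ∀ b' ∈ Θ, ∀ t ∈ T, ∀ t' ∈ T, ∀ ε₁ ε₂ m₁ m₂ : ℤ,
      |ε₁| ≤ (P / (8 * (9 * l)) : ℕ) → |ε₂| ≤ (P / (8 * (9 * l)) : ℕ) →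
      (b.val : ℤ) * cfMat (u g t) 1 0 - b'.val * cfMat (u g t') 1 0 = ε₁ + P * m₁ →
      (b.val : ℤ) * cfMat (u g t) 1 1 - b'.val * cfMat (u g t') 1 1 = ε₂ + P * m₂ →
      t = t' ∧ ∃ k : ℤ, |(b.val : ℤ) - b'.val - k * P| ≤ 21) :
    ∑ b ∈ Θ, ‖∑ g ∈ G, ∑ t ∈ T, ∑ v ∈ V, (stdAddChar (b * (cfDen (u g t ++ v) : ZMod P)) : ℂ)‖ ^ 2 ≤
      1024 * 43 * (9 * l) ^ 2 * (G.card ^ 2 * T.card * V.card) := by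
  have := sum_norm_sq_le_of_card_box_le (L := 9 * l) (D := 43) Θ G T V u h.box.1 h.box.2.1
    h.V_unif h.V_pos (by exact_mod_cast h.V_le)
    (fun g hg z₁ z₂ => card_box_le Θ T (u g) (hsep g hg) z₁ z₂)
  exact_mod_cast this

theorem box_mul_le (h : IsSplit P m l G T V u) :
    2 * (2 * (((P / (8 * (9 * l)) : ℕ) : ℤ) * (9 * m))) ≤ 81 * (m : ℤ) ^ 2 := by
  have h3 : (4 * (P / (8 * (9 * l)) : ℕ) : ℤ) ≤ 9 * m := by exact_mod_cast h.box.2.2.2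
  have : (0 : ℤ) ≤ m := by positivity
  nlinarith

theorem major_ineq (h : IsSplit P m l G T V u) {Z : ℕ} (hZ : 1 ≤ Z) (hZl : 4 * Z ^ 3 ≤ 9 * l) :
    (Z : ℤ) ^ 2 * (P / (8 * (9 * l)) : ℕ) + 2 * ((Z : ℤ) ^ 3 * (9 * m)) < P := by
  have h1 := h.box.1
  have h2 := h.le_P
  have h3 := h.m_pos
  have h4 := h.l_pos
  set Q := P / (8 * (9 * l))
  have k1 : Z ^ 2 ≤ Z ^ 3 := Nat.pow_le_pow_right hZ (by norm_num)
  have k2 : 4 * Z ^ 2 * Q ≤ 9 * l * Q := Nat.mul_le_mul_right _ (by linarith)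
  have k3 : 4 * Z ^ 3 * (9 * m) ≤ 9 * l * (9 * m) := Nat.mul_le_mul_right _ hZl
  have k4 : 0 < m * l := by positivity
  have : Z ^ 2 * Q + 2 * (Z ^ 3 * (9 * m)) < P := by nlinarith
  exact_mod_cast this

theorem major_large_denominator (h : IsSplit P m l G T V u) [NeZero P] {Z Z' : ℕ} (hZ : 1 ≤ Z)
    (hZl : 4 * Z ^ 3 ≤ 9 * l) (Θ : Finset (ZMod P))
    (hΘ : ∀ b ∈ Θ, ∃ q a : ℤ, 1 ≤ q ∧ q ≤ Z ∧ IsCoprime a q ∧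
      |(b.val : ℤ) * q - a * P| ≤ Z * q ∧ Z' < q)
    (hne : ∀ g ∈ G, ∀ t ∈ T, ∀ t' ∈ T, t ≠ t' → cfWedge (u g t) (u g t') ≠ 0)
    (hle : ∀ g ∈ G, ∀ t ∈ T, ∀ t' ∈ T, |cfWedge (u g t) (u g t')| ≤ Z') :
    ∑ b ∈ Θ, ‖∑ g ∈ G, ∑ t ∈ T, ∑ v ∈ V,
        (ZMod.stdAddChar (b * (cfDen (u g t ++ v) : ZMod P)) : ℂ)‖ ^ 2 ≤
      1024 * 43 * (9 * l) ^ 2 * (G.card ^ 2 * T.card * V.card) := by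
  refine h.sum_le Θ fun g hg b hb b' hb' t ht t' ht' ε₁ ε₂ m₁ m₂ hε₁ hε₂ e₁ e₂ => ?_
  obtain ⟨q, a, hq, hqZ, hc, hr, hZ'⟩ := hΘ b hb
  obtain ⟨q', a', hq', hqZ', hc', hr', -⟩ := hΘ b' hb'
  obtain ⟨rfl, ⟨f₁, f₂⟩, g₁, g₂⟩ := major_arcs hq hqZ hq' hqZ' hr hr' (by ring) (by ring) hc hc'
    (h.major_ineq hZ hZl) hε₁ hε₂ (h.abs_row_le hg ht 0) (h.abs_row_le hg ht' 0)
    (h.abs_row_le hg ht 1) (h.abs_row_le hg ht' 1) (isCoprime_cfMat_row _)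
    (isCoprime_cfMat_row _) e₁ e₂
  have htt : t = t' := by
    by_contra hn
    have h1 := Int.le_of_dvd (abs_pos.2 (hne g hg t ht t' ht' hn))
      ((dvd_abs _ _).2 (dvd_wedge hc f₁ f₂))
    linarith [hle g hg t ht t' ht']
  subst htt
  obtain ⟨k, hk⟩ := major_same_word (P := P) (b := b.val) (b' := b'.val) hq
    (isCoprime_cfMat_row _) (add_sub_cancel _ _).symm (add_sub_cancel _ _).symm f₁ f₂ g₂
  exact ⟨rfl, k, h.abs_le_of_mul hg ht hε₂ hk⟩

theorem major_large_remainder (h : IsSplit P m l G T V u) [NeZero P] {Z Z' : ℕ} (hZ : 1 ≤ Z)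
    (hZl : 4 * Z ^ 3 ≤ 9 * l) (Θ : Finset (ZMod P))
    (hΘ : ∀ b ∈ Θ, ∃ q a : ℤ, 1 ≤ q ∧ q ≤ Z ∧ IsCoprime a q ∧
      |(b.val : ℤ) * q - a * P| ≤ Z * q ∧ Z' * q < |(b.val : ℤ) * q - a * P|)
    (hlt : ∀ g ∈ G, ∀ t ∈ T, ∀ t' ∈ T, t ≠ t' →
      81 * (m : ℤ) ^ 2 < 2 * (Z' * |cfWedge (u g t) (u g t')|)) :
    ∑ b ∈ Θ, ‖∑ g ∈ G, ∑ t ∈ T, ∑ v ∈ V,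
        (ZMod.stdAddChar (b * (cfDen (u g t ++ v) : ZMod P)) : ℂ)‖ ^ 2 ≤
      1024 * 43 * (9 * l) ^ 2 * (G.card ^ 2 * T.card * V.card) := by
  refine h.sum_le Θ fun g hg b hb b' hb' t ht t' ht' ε₁ ε₂ m₁ m₂ hε₁ hε₂ e₁ e₂ => ?_
  obtain ⟨q, a, hq, hqZ, hc, hr, hZ'⟩ := hΘ b hb
  obtain ⟨q', a', hq', hqZ', hc', hr', -⟩ := hΘ b' hb'
  obtain ⟨rfl, ⟨f₁, f₂⟩, g₁, g₂⟩ := major_arcs hq hqZ hq' hqZ' hr hr' (by ring) (by ring) hc hc'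
    (h.major_ineq hZ hZl) hε₁ hε₂ (h.abs_row_le hg ht 0) (h.abs_row_le hg ht' 0)
    (h.abs_row_le hg ht 1) (h.abs_row_le hg ht' 1) (isCoprime_cfMat_row _)
    (isCoprime_cfMat_row _) e₁ e₂
  have htt : t = t' := by
    by_contra hn
    have h1 := mul_abs_wedge_le hq hZ' hε₁ hε₂ (h.abs_row_le hg ht' 0) (h.abs_row_le hg ht' 1) g₁ g₂
    have h2 := hlt g hg t ht t' ht' hn
    have h3 := h.box_mul_le
    simp only [cfWedge] at h2
    linarith
  subst htt
  obtain ⟨k, hk⟩ := major_same_word (P := P) (b := b.val) (b' := b'.val) hq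
    (isCoprime_cfMat_row _) (add_sub_cancel _ _).symm (add_sub_cancel _ _).symm f₁ f₂ g₂
  exact ⟨rfl, k, h.abs_le_of_mul hg ht hε₂ hk⟩

theorem minor (h : IsSplit P m l G T V u) [NeZero P] {Z : ℕ} (hml : m < 4 * l)
    (hmZ : 81 * m ^ 2 ≤ 2 * Z) (Θ : Finset (ZMod P)) (hΘ : ∀ b ∈ Θ, ¬ App P Z b)
    (hne : ∀ g ∈ G, ∀ t ∈ T, ∀ t' ∈ T, t ≠ t' → cfWedge (u g t) (u g t') ≠ 0)
    (hle : ∀ g ∈ G, ∀ t ∈ T, ∀ t' ∈ T, |cfWedge (u g t) (u g t')| ≤ Z) :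
    ∑ b ∈ Θ, ‖∑ g ∈ G, ∑ t ∈ T, ∑ v ∈ V,
        (ZMod.stdAddChar (b * (cfDen (u g t ++ v) : ZMod P)) : ℂ)‖ ^ 2 ≤
      1024 * 43 * (9 * l) ^ 2 * (G.card ^ 2 * T.card * V.card) := by
  refine h.sum_le Θ fun g hg b hb b' hb' t ht t' ht' ε₁ ε₂ m₁ m₂ hε₁ hε₂ e₁ e₂ => ?_
  have htt : t = t' := by
    by_contra hn
    obtain ⟨n, hn'⟩ := exists_abs_mul_wedge_sub_le hε₁ hε₂ (h.abs_row_le hg ht' 0)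
      (h.abs_row_le hg ht' 1) e₁ e₂
    refine hΘ b hb (App.of_abs_le (hne g hg t ht t' ht' hn) (hle g hg t ht t' ht') (hn'.trans ?_))
    have h3 := h.box_mul_le
    have h4 : 81 * (m : ℤ) ^ 2 ≤ 2 * Z := by exact_mod_cast hmZ
    linarith
  subst htt
  have h5 : 2 * (((P / (8 * (9 * l)) : ℕ) : ℤ) * (9 * m)) < P := by
    have h1 := h.box.1
    have h2 := h.box.2.2.1
    set Q := P / (8 * (9 * l))
    have : 2 * (Q * (9 * m)) < P := by nlinarith
    exact_mod_cast this
  obtain ⟨k, hk⟩ := minor_same_word h5 (isCoprime_cfMat_row _) hε₁ hε₂ (h.abs_row_le hg ht 0)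
    (h.abs_row_le hg ht 1) e₁ e₂
  exact ⟨rfl, k, h.abs_le_of_mul hg ht hε₂ hk⟩

end IsSplit

/-! ### The ensemble of words and its exponential sums -/

/-- The words `u f v` with `u` from the first `7 I` blocks in increasing order and `v` from the
first `21 I` blocks in decreasing order. -/
def ens (B : ℕ → Finset (List ℕ)) (I : ℕ) (f : List ℕ) : Finset (List ℕ) :=
  cat (blockCat B (List.range (7 * I))) (cat {f} (blockCat B (List.range (21 * I)).reverse))

/-- The indices from `a` to `a + n - 1`. -/
def seg (a n : ℕ) : List ℕ := (List.range n).map (a + ·)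

theorem range_add_eq (a n : ℕ) : List.range (a + n) = List.range a ++ seg a n := List.range_add

theorem pinConst_seg_le (a n : ℕ) : pinConst (seg a n) ≤ 3 := by
  have h := pinConst_range_le (a + n)
  rw [range_add_eq, pinConst_append] at h
  nlinarith [one_le_pinConst (List.range a), one_le_pinConst (seg a n)]

theorem sum_map_reverse (s : List ℕ) (g : ℕ → ℕ) : (s.reverse.map g).sum = (s.map g).sum := by
  rw [List.map_reverse, List.sum_reverse]

theorem two_mul_sum_seg_add_one (a n : ℕ) :
    2 * ((seg a n).map (· + 1)).sum + a * (a + 1) = (a + n) * (a + n + 1) := by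
  have h := two_mul_sum_range_add_one (a + n)
  rw [range_add_eq, List.map_append, List.sum_append, mul_add, two_mul_sum_range_add_one] at h
  linarith

theorem two_mul_sum_seg_add_two (a n : ℕ) :
    2 * ((seg a n).map (· + 2)).sum + a * (a + 3) = (a + n) * (a + n + 3) := by
  have h := two_mul_sum_range_add_two (a + n)
  rw [range_add_eq, List.map_append, List.sum_append, mul_add, two_mul_sum_range_add_two] at h
  linarith

open ZMod in
/-- The exponential sum over the denominators of a set of words. -/
noncomputable def expSum {P : ℕ} [NeZero P] (Ω : Finset (List ℕ)) (b : ZMod P) : ℂ :=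
  ∑ w ∈ Ω, (stdAddChar (b * (cfDen w : ZMod P)) : ℂ)

structure IsEnsemble (A : Finset ℕ) (X α I : ℕ) (B : ℕ → Finset (List ℕ)) (f w₀ : List ℕ) :
    Prop where
  blocks : IsBlockSeq A X B
  zero_notMem : 0 ∉ A
  le_α : ∀ d ∈ A, d ≤ α
  le_X : 13200 * (α + 1) ≤ X
  le_I : 100 ≤ I
  f_letters : ∀ d ∈ f, d ∈ A
  f_le : cfDen f ≤ (X : ℤ) ^ (I ^ 2)
  w₀_mem : w₀ ∈ ens B I f

theorem isSplit_of_mem {Λ G T V : Finset (List ℕ)} {u : List ℕ → List ℕ → List ℕ}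
    {u₀ v₀ : List ℕ} (hΛ : Pinned 9 Λ) (hV : Pinned 9 V) (hΛ1 : ∀ w ∈ Λ, ∀ d ∈ w, 1 ≤ d)
    (hV1 : ∀ w ∈ V, ∀ d ∈ w, 1 ≤ d) (hVu : Uniform V) (hu₀ : u₀ ∈ Λ) (hv₀ : v₀ ∈ V)
    (hu : ∀ g ∈ G, ∀ t ∈ T, u g t ∈ Λ) :
    IsSplit (81 * (cfDen (u₀ ++ v₀)).toNat) (cfDen u₀).toNat (cfDen v₀).toNat G T V u := by
  have h1 := one_le_cfDen (hΛ1 u₀ hu₀)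
  have h2 := one_le_cfDen (hV1 v₀ hv₀)
  have h3 := cfDen_mul_le (hΛ1 u₀ hu₀) (hV1 v₀ hv₀)
  have h4 := cfDen_append_le (hΛ1 u₀ hu₀) (hV1 v₀ hv₀)
  have e1 : ((cfDen u₀).toNat : ℤ) = cfDen u₀ := Int.toNat_of_nonneg (by linarith)
  have e2 : ((cfDen v₀).toNat : ℤ) = cfDen v₀ := Int.toNat_of_nonneg (by linarith)
  have e3 : ((cfDen (u₀ ++ v₀)).toNat : ℤ) = cfDen (u₀ ++ v₀) :=
    Int.toNat_of_nonneg (by nlinarith)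
  have p1 : ∀ w ∈ Λ, ∀ w' ∈ Λ, cfDen w ≤ 9 * cfDen w' := fun w hw w' hw' => by
    have := hΛ w hw w' hw' 1 1
    exact_mod_cast this
  have p2 : ∀ w ∈ V, ∀ w' ∈ V, cfDen w ≤ 9 * cfDen w' := fun w hw w' hw' => by
    have := hV w hw w' hw' 1 1
    exact_mod_cast this
  exact
  { m_pos := by omega
    l_pos := by omega
    le_P := by zify; rw [e1, e2, e3]; linarith
    P_le := by zify; rw [e1, e2, e3]; linarith
    u_pos := fun g hg t ht => hΛ1 _ (hu g hg t ht)
    le_u := fun g hg t ht => by rw [e1]; exact p1 _ hu₀ _ (hu g hg t ht)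
    u_le := fun g hg t ht => by rw [e1]; exact p1 _ (hu g hg t ht) _ hu₀
    V_unif := hVu
    V_pos := hV1
    V_le := fun v hv => by rw [e2]; exact p2 v hv _ hv₀ }

/-- Converts the exponents of `X` into the saving of the large sieve. -/
theorem large_sieve_saving {X l a t v i : ℕ} {g T V : ℝ} (hX : 1 ≤ X) (hT : 0 ≤ T) (hV : 0 ≤ V)
    (hl : l ≤ X ^ a) (ht : (X : ℝ) ^ (46 * t) ≤ T ^ 25) (hv : (X : ℝ) ^ (46 * v) ≤ V ^ 25)
    (h : 50 * a + 25 * i ≤ 46 * (t + v)) :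
    1024 * 43 * (9 * (l : ℝ)) ^ 2 * (g ^ 2 * T * V) ≤
      1024 * 43 * 81 * (1 / X) ^ i * (g * T * V) ^ 2 := by
  have hX' : (1 : ℝ) ≤ X := by exact_mod_cast hX
  have hX0 : (0 : ℝ) < X := by linarith
  have hl' : (l : ℝ) ≤ (X : ℝ) ^ a := by exact_mod_cast hl
  have key : (l : ℝ) ^ 2 * (X : ℝ) ^ i ≤ T * V := by
    refine le_of_pow_le_pow_left₀ (by norm_num : 25 ≠ 0) (by positivity) ?_
    calc ((l : ℝ) ^ 2 * (X : ℝ) ^ i) ^ 25 ≤ (((X : ℝ) ^ a) ^ 2 * (X : ℝ) ^ i) ^ 25 := by gcongr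
      _ = (X : ℝ) ^ (50 * a + 25 * i) := by
          rw [← pow_mul, ← pow_add, ← pow_mul]; congr 1; ring
      _ ≤ (X : ℝ) ^ (46 * (t + v)) := pow_le_pow_right₀ hX' h
      _ = (X : ℝ) ^ (46 * t) * (X : ℝ) ^ (46 * v) := by rw [mul_add, pow_add]
      _ ≤ T ^ 25 * V ^ 25 := by gcongr
      _ = _ := by rw [mul_pow]
  have key2 : (l : ℝ) ^ 2 ≤ (1 / X) ^ i * (T * V) := by
    rw [one_div, inv_pow, inv_mul_eq_div, le_div_iff₀ (by positivity)]
    exact key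
  calc _ = 1024 * 43 * 81 * (g ^ 2 * (T * V)) * (l : ℝ) ^ 2 := by ring
    _ ≤ 1024 * 43 * 81 * (g ^ 2 * (T * V)) * ((1 / X) ^ i * (T * V)) := by gcongr
    _ = _ := by ring

namespace IsEnsemble

variable {A : Finset ℕ} {X α I : ℕ} {B : ℕ → Finset (List ℕ)} {f w₀ : List ℕ}

theorem one_le_X (h : IsEnsemble A X α I B f w₀) : 1 ≤ X := by
  have := h.le_X; omega

theorem pos_block (h : IsEnsemble A X α I B f w₀) (s : List ℕ) :
    ∀ w ∈ blockCat B s, ∀ d ∈ w, 1 ≤ d := fun w hw =>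
  IsBlockSeq.pos_of_mem h.zero_notMem (h.blocks.letters_blockCat s w hw)

theorem pos_f (h : IsEnsemble A X α I B f w₀) : ∀ w ∈ ({f} : Finset (List ℕ)), ∀ d ∈ w, 1 ≤ d := by
  intro w hw
  rw [Finset.mem_singleton.1 hw]
  exact IsBlockSeq.pos_of_mem h.zero_notMem h.f_letters

theorem pinned_block (h : IsEnsemble A X α I B f w₀) (a n : ℕ) :
    Pinned 3 (blockCat B (seg a n)) :=
  (h.blocks.pinned_blockCat h.zero_notMem _).mono (pinConst_seg_le a n) (h.pos_block _)

theorem pinned_block_reverse (h : IsEnsemble A X α I B f w₀) (a n : ℕ) :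
    Pinned 3 (blockCat B (seg a n).reverse) :=
  (h.blocks.pinned_blockCat h.zero_notMem _).mono
    (by rw [pinConst_reverse]; exact pinConst_seg_le a n) (h.pos_block _)

theorem seg_zero (n : ℕ) : seg 0 n = List.range n := by simp [seg]

theorem pinned_right (h : IsEnsemble A X α I B f w₀) (n : ℕ) :
    Pinned 9 (blockCat B (List.range n).reverse) := by
  have := h.pinned_block_reverse 0 n
  rw [seg_zero] at this
  exact this.mono (by norm_num) (h.pos_block _)

theorem pinned_left (h : IsEnsemble A X α I B f w₀) (a n : ℕ) :
    Pinned 9 (cat (blockCat B (List.range (7 * I))) (cat {f} (blockCat B (seg a n).reverse))) := by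
  have h1 := h.pinned_block 0 (7 * I)
  rw [seg_zero] at h1
  have h2 := Pinned.cat zero_le_one (pinned_singleton f) (h.pinned_block_reverse a n)
    h.pos_f (h.pos_block _)
  have h3 := Pinned.cat (by norm_num) h1 h2 (h.pos_block _) (letters_cat h.pos_f (h.pos_block _))
  exact h3.mono (by norm_num)
    (letters_cat (h.pos_block _) (letters_cat h.pos_f (h.pos_block _)))

theorem pos_left (h : IsEnsemble A X α I B f w₀) (s s' : List ℕ) :
    ∀ w ∈ cat (blockCat B s) (cat {f} (blockCat B s')), ∀ d ∈ w, 1 ≤ d :=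
  letters_cat (h.pos_block _) (letters_cat h.pos_f (h.pos_block _))

/-- Splitting off the last `n` blocks on the right. -/
theorem ens_eq (B : ℕ → Finset (List ℕ)) (f : List ℕ) {n : ℕ} (hn : n ≤ 21 * I) :
    ens B I f = cat (cat (blockCat B (List.range (7 * I)))
      (cat {f} (blockCat B (seg n (21 * I - n)).reverse))) (blockCat B (List.range n).reverse) := by
  rw [ens, ← Nat.add_sub_cancel' hn, range_add_eq, List.reverse_append, blockCat_append,
    Nat.add_sub_cancel' hn]
  simp only [cat_assoc]

theorem le_of_mem_right (h : IsEnsemble A X α I B f w₀) {n e : ℕ} (he : n * (n + 3) ≤ 2 * e)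
    {v : List ℕ} (hv : v ∈ blockCat B (List.range n).reverse) : (cfDen v).toNat ≤ X ^ e := by
  have h1 := h.blocks.cfDen_blockCat_le h.zero_notMem _ v hv
  rw [sum_map_reverse] at h1
  have h2 := two_mul_sum_range_add_two n
  have h3 : X ^ ((List.range n).map (· + 2)).sum ≤ X ^ e :=
    Nat.pow_le_pow_right h.one_le_X (by omega)
  have h4 : ((X ^ ((List.range n).map (· + 2)).sum : ℕ) : ℤ) ≤ (X ^ e : ℕ) := by exact_mod_cast h3
  push_cast at h4
  rw [Int.toNat_le]
  push_cast
  exact h1.trans h4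

theorem ge_of_mem_right (h : IsEnsemble A X α I B f w₀) {n e : ℕ} (he : 2 * e ≤ n * (n + 1))
    {v : List ℕ} (hv : v ∈ blockCat B (List.range n).reverse) : X ^ e ≤ (cfDen v).toNat := by
  have h1 := h.blocks.le_cfDen_blockCat h.zero_notMem _ v hv
  rw [sum_map_reverse] at h1
  have h2 := two_mul_sum_range_add_one n
  have h3 : X ^ e ≤ X ^ ((List.range n).map (· + 1)).sum :=
    Nat.pow_le_pow_right h.one_le_X (by omega)
  have h4 : ((X ^ e : ℕ) : ℤ) ≤ (X ^ ((List.range n).map (· + 1)).sum : ℕ) := by exact_mod_cast h3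
  push_cast at h4
  zify
  rw [Int.toNat_of_nonneg (zero_le_one.trans (one_le_cfDen (h.pos_block _ v hv)))]
  exact h4.trans h1

theorem le_of_mem_left (h : IsEnsemble A X α I B f w₀) {n e : ℕ} (he : n * (n + 3) ≤ 2 * e)
    {t : List ℕ} (ht : t ∈ blockCat B (List.range n)) : cfDen t ≤ (X ^ e : ℕ) := by
  have h1 := h.blocks.cfDen_blockCat_le h.zero_notMem _ t ht
  have h2 := two_mul_sum_range_add_two n
  have h3 : X ^ ((List.range n).map (· + 2)).sum ≤ X ^ e :=
    Nat.pow_le_pow_right h.one_le_X (by omega)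
  exact h1.trans (by exact_mod_cast h3)

theorem abs_cfWedge_le {t t' : List ℕ} {Y : ℤ} (ht : ∀ d ∈ t, 1 ≤ d) (ht' : ∀ d ∈ t', 1 ≤ d)
    (h : cfDen t ≤ Y) (h' : cfDen t' ≤ Y) : |cfWedge t t'| ≤ Y ^ 2 := by
  have a1 := cfMat_nonneg ht 1 0
  have a2 := cfMat_nonneg ht' 1 0
  have a3 := cfMat_le_cfDen ht 1 0
  have a4 := cfMat_le_cfDen ht' 1 0
  have a5 := one_le_cfDen ht
  have a6 := one_le_cfDen ht'
  unfold cfDen at *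
  have b1 : cfMat t 1 0 * cfMat t' 1 1 ≤ Y * Y :=
    mul_le_mul (a3.trans h) h' (by linarith) (by linarith)
  have b2 : cfMat t 1 1 * cfMat t' 1 0 ≤ Y * Y :=
    mul_le_mul h (a4.trans h') a2 (by linarith)
  have b3 : 0 ≤ cfMat t 1 0 * cfMat t' 1 1 := mul_nonneg a1 (by linarith)
  have b4 : 0 ≤ cfMat t 1 1 * cfMat t' 1 0 := mul_nonneg (by linarith) a2
  rw [cfWedge, abs_le]
  constructor <;> nlinarith

end IsEnsemble

theorem seg_add (a m n : ℕ) : seg a (m + n) = seg a m ++ seg (a + m) n := by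
  simp only [seg, List.range_add, List.map_append, List.map_map]
  congr 1
  exact List.map_congr_left fun x _ => by simp [add_assoc]

open ZMod in
theorem expSum_cat_cat {P : ℕ} [NeZero P] {F G : Finset (List ℕ)} (hF : Uniform F)
    (hG : Uniform G) (V : Finset (List ℕ)) (b : ZMod P) :
    expSum (cat (cat F G) V) b =
      ∑ x ∈ F, ∑ y ∈ G, ∑ v ∈ V, (stdAddChar (b * (cfDen (x ++ y ++ v) : ZMod P)) : ℂ) := by
  rw [expSum, sum_cat (hF.cat hG), sum_cat hF]

namespace IsEnsemble

variable {A : Finset ℕ} {X α I : ℕ} {B : ℕ → Finset (List ℕ)} {f w₀ : List ℕ}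

theorem four_mul_cube_le (h : IsEnsemble A X α I B f w₀) {i : ℕ} (hi : 1 ≤ i) {v : List ℕ}
    (hv : v ∈ blockCat B (List.range (20 * i)).reverse) :
    4 * (X ^ (66 * i ^ 2)) ^ 3 ≤ 9 * (cfDen v).toNat := by
  have h1 : X ^ (10 * i * (20 * i + 1)) ≤ (cfDen v).toNat :=
    h.ge_of_mem_right (n := 20 * i) (by nlinarith) hv
  have h2 : (X ^ (66 * i ^ 2)) ^ 3 * X ≤ X ^ (10 * i * (20 * i + 1)) := by
    rw [← pow_mul, ← pow_succ]
    exact Nat.pow_le_pow_right h.one_le_X (by nlinarith)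
  have h3 : (X ^ (66 * i ^ 2)) ^ 3 * 4 ≤ (X ^ (66 * i ^ 2)) ^ 3 * X :=
    Nat.mul_le_mul_left _ (by have := h.le_X; omega)
  omega

theorem isSplit_layer (h : IsEnsemble A X α I B f w₀) {i : ℕ} (hi : i ≤ I) :
    ∃ u₀ v₀ : List ℕ, v₀ ∈ blockCat B (List.range (20 * i)).reverse ∧
      u₀ ∈ cat (blockCat B (List.range (7 * I)))
        (cat {f} (blockCat B (seg (20 * i) (21 * I - 20 * i)).reverse)) ∧ u₀ ++ v₀ = w₀ := by
  have h1 := h.w₀_mem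
  rw [ens_eq B f (n := 20 * i) (by omega)] at h1
  obtain ⟨u₀, hu, v₀, hv, e⟩ := mem_cat.1 h1
  exact ⟨u₀, v₀, hv, hu, e⟩

theorem sum_large_denominator (h : IsEnsemble A X α I B f w₀) {P : ℕ} [NeZero P]
    (hP : P = 81 * (cfDen w₀).toNat) {j : ℕ} (hj : 20 ≤ j) (hjI : j + 1 ≤ I)
    (Θ : Finset (ZMod P))
    (hΘ : ∀ b ∈ Θ, ∃ q a : ℤ, 1 ≤ q ∧ q ≤ (X ^ (66 * (j + 1) ^ 2) : ℕ) ∧ IsCoprime a q ∧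
      |(b.val : ℤ) * q - a * P| ≤ (X ^ (66 * (j + 1) ^ 2) : ℕ) * q ∧ (X ^ (66 * j ^ 2) : ℕ) < q) :
    ∑ b ∈ Θ, ‖expSum (ens B I f) b‖ ^ 2 ≤
      1024 * 43 * 81 * (1 / X) ^ (j + 1) * ((ens B I f).card : ℝ) ^ 2 := by
  obtain ⟨u₀, v₀, hv₀, hu₀, rfl⟩ := h.isSplit_layer hjI
  subst hP
  set i := j + 1 with hi
  set T := blockCat B (List.range (7 * i)) with hT
  set G := cat (blockCat B (seg (7 * i) (7 * I - 7 * i)))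
    (cat {f} (blockCat B (seg (20 * i) (21 * I - 20 * i)).reverse)) with hG
  set V := blockCat B (List.range (20 * i)).reverse with hV
  have hΛ : cat (blockCat B (List.range (7 * I)))
        (cat {f} (blockCat B (seg (20 * i) (21 * I - 20 * i)).reverse)) = cat T G := by
    have : List.range (7 * I) = List.range (7 * i) ++ seg (7 * i) (7 * I - 7 * i) := by
      rw [← range_add_eq]; congr 1; omega
    rw [this, blockCat_append, hT, hG, cat_assoc]
  have hΩ : ens B I f = cat (cat T G) V := by
    rw [ens_eq B f (n := 20 * i) (by omega), hΛ]
  have hTU : Uniform T := h.blocks.uniform_blockCat _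
  have hVU : Uniform V := h.blocks.uniform_blockCat _
  have hGU : Uniform G := (h.blocks.uniform_blockCat _).cat
    ((uniform_singleton f).cat (h.blocks.uniform_blockCat _))
  have hs : IsSplit (81 * (cfDen (u₀ ++ v₀)).toNat) (cfDen u₀).toNat (cfDen v₀).toNat G T V
      (fun g t => t ++ g) :=
    isSplit_of_mem (h.pinned_left _ _) (h.pinned_right _) (h.pos_left _ _) (h.pos_block _) hVU hu₀
      hv₀ fun g hg t ht => by rw [hΛ]; exact mem_cat.2 ⟨t, ht, g, hg, rfl⟩
  have hsum := hs.major_large_denominator (Z := X ^ (66 * i ^ 2)) (Z' := X ^ (66 * j ^ 2))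
    (Nat.one_le_pow _ _ h.one_le_X) (h.four_mul_cube_le (by omega) hv₀) Θ hΘ
    (fun g hg t ht t' ht' hne => by
      rw [← abs_pos, abs_cfWedge_append, abs_pos]
      exact cfWedge_ne_zero (h.pos_block _ _ ht) (h.pos_block _ _ ht') (hTU _ ht _ ht') hne)
    (fun g hg t ht t' ht' => by
      rw [abs_cfWedge_append]
      have e := two_mul_sum_range_add_two (7 * i)
      have h1 := abs_cfWedge_le (h.pos_block _ _ ht) (h.pos_block _ _ ht')
        (h.le_of_mem_left e.ge ht) (h.le_of_mem_left e.ge ht')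
      refine h1.trans ?_
      have h2 : (X ^ ((List.range (7 * i)).map (· + 2)).sum) ^ 2 ≤ X ^ (66 * j ^ 2) := by
        rw [← pow_mul]
        refine Nat.pow_le_pow_right h.one_le_X ?_
        rw [mul_comm, e, hi]
        nlinarith
      exact_mod_cast h2)
  have hsave := large_sieve_saving (X := X) (l := (cfDen v₀).toNat) (a := 10 * i * (20 * i + 3))
    (i := i) (g := G.card) (T := T.card) (V := V.card) h.one_le_X (by positivity) (by positivity)
    (h.le_of_mem_right (by nlinarith) hv₀) (h.blocks.card_blockCat _) (h.blocks.card_blockCat _) (by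
      have e1 := two_mul_sum_range_add_one (7 * i)
      have e2 := two_mul_sum_range_add_one (20 * i)
      rw [sum_map_reverse]
      nlinarith)
  have hexp : ∀ b : ZMod (81 * (cfDen (u₀ ++ v₀)).toNat), expSum (ens B I f) b =
      ∑ g ∈ G, ∑ t ∈ T, ∑ v ∈ V, (ZMod.stdAddChar
        (b * (cfDen (t ++ g ++ v) : ZMod (81 * (cfDen (u₀ ++ v₀)).toNat))) : ℂ) := fun b => by
    rw [hΩ, expSum_cat_cat hTU hGU, Finset.sum_comm]
  have hcard : ((ens B I f).card : ℝ) = G.card * T.card * V.card := by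
    rw [hΩ, card_cat (hTU.cat hGU), card_cat hTU]; push_cast; ring
  simp only [hexp, hcard]
  exact hsum.trans hsave

theorem ne_nil_of_mem (h : IsEnsemble A X α I B f w₀) {s : List ℕ} {g : List ℕ}
    (hg : g ∈ cat (blockCat B (List.range (7 * I))) (cat {f} (blockCat B s))) : g ≠ [] := by
  rintro rfl
  obtain ⟨u, hu, y, -, e⟩ := mem_cat.1 hg
  obtain ⟨rfl, -⟩ := List.append_eq_nil_iff.1 e
  have h1 := h.blocks.le_cfDen_blockCat h.zero_notMem _ _ hu
  have h2 := two_mul_sum_range_add_one (7 * I)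
  have h3 := h.le_I
  have h4 : X ^ 1 ≤ X ^ ((List.range (7 * I)).map (· + 1)).sum :=
    Nat.pow_le_pow_right h.one_le_X (by nlinarith)
  have h5 : ((X ^ 1 : ℕ) : ℤ) ≤ (X ^ ((List.range (7 * I)).map (· + 1)).sum : ℕ) := by
    exact_mod_cast h4
  have h6 := h.le_X
  have h7 : cfDen [] = 1 := by simp [cfDen, cfMat]
  push_cast at h5
  rw [pow_one] at h5
  rw [h7] at h1
  omega

theorem letters_left (h : IsEnsemble A X α I B f w₀) {s s' : List ℕ} :
    ∀ w ∈ cat (blockCat B s) (cat {f} (blockCat B s')), ∀ d ∈ w, 1 ≤ d ∧ d ≤ α := fun w hw d hd =>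
  ⟨h.pos_left s s' w hw d hd, h.le_α d (letters_cat (p := (· ∈ A)) (h.blocks.letters_blockCat s)
    (letters_cat (by simpa using h.f_letters) (h.blocks.letters_blockCat s')) w hw d hd)⟩

theorem letters_block (h : IsEnsemble A X α I B f w₀) (s : List ℕ) :
    ∀ w ∈ blockCat B s, ∀ d ∈ w, 1 ≤ d ∧ d ≤ α := fun w hw d hd =>
  ⟨h.pos_block s w hw d hd, h.le_α d (h.blocks.letters_blockCat s w hw d hd)⟩

theorem sum_large_remainder (h : IsEnsemble A X α I B f w₀) {P : ℕ} [NeZero P]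
    (hP : P = 81 * (cfDen w₀).toNat) {j : ℕ} (hj : 20 ≤ j) (hjI : j + 1 ≤ I)
    (Θ : Finset (ZMod P))
    (hΘ : ∀ b ∈ Θ, ∃ q a : ℤ, 1 ≤ q ∧ q ≤ (X ^ (66 * (j + 1) ^ 2) : ℕ) ∧ IsCoprime a q ∧
      |(b.val : ℤ) * q - a * P| ≤ (X ^ (66 * (j + 1) ^ 2) : ℕ) * q ∧
      (X ^ (66 * j ^ 2) : ℕ) * q < |(b.val : ℤ) * q - a * P|) :
    ∑ b ∈ Θ, ‖expSum (ens B I f) b‖ ^ 2 ≤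
      1024 * 43 * 81 * (1 / X) ^ (j + 1) * ((ens B I f).card : ℝ) ^ 2 := by
  obtain ⟨u₀, v₀, hv₀, hu₀, rfl⟩ := h.isSplit_layer hjI
  subst hP
  set i := j + 1 with hi
  set T := blockCat B (seg (20 * i) i).reverse with hT
  set G := cat (blockCat B (List.range (7 * I)))
    (cat {f} (blockCat B (seg (21 * i) (21 * I - 21 * i)).reverse)) with hG
  set V := blockCat B (List.range (20 * i)).reverse with hV
  have hΛ : cat (blockCat B (List.range (7 * I)))
        (cat {f} (blockCat B (seg (20 * i) (21 * I - 20 * i)).reverse)) = cat G T := by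
    have : seg (20 * i) (21 * I - 20 * i) = seg (20 * i) i ++ seg (21 * i) (21 * I - 21 * i) := by
      rw [show 21 * i = 20 * i + i by ring, ← seg_add]; congr 1; omega
    rw [this, List.reverse_append, blockCat_append, hT, hG]
    simp only [cat_assoc]
  have hΩ : ens B I f = cat (cat G T) V := by
    rw [ens_eq B f (n := 20 * i) (by omega), hΛ]
  have hTU : Uniform T := h.blocks.uniform_blockCat _
  have hVU : Uniform V := h.blocks.uniform_blockCat _
  have hGU : Uniform G := (h.blocks.uniform_blockCat _).cat
    ((uniform_singleton f).cat (h.blocks.uniform_blockCat _))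
  have hs : IsSplit (81 * (cfDen (u₀ ++ v₀)).toNat) (cfDen u₀).toNat (cfDen v₀).toNat G T V
      (fun g t => g ++ t) :=
    isSplit_of_mem (h.pinned_left _ _) (h.pinned_right _) (h.pos_left _ _) (h.pos_block _) hVU hu₀
      hv₀ fun g hg t ht => by rw [hΛ]; exact mem_cat.2 ⟨g, hg, t, ht, rfl⟩
  have hsum := hs.major_large_remainder (Z := X ^ (66 * i ^ 2)) (Z' := X ^ (66 * j ^ 2))
    (Nat.one_le_pow _ _ h.one_le_X) (h.four_mul_cube_le (by omega) hv₀) Θ hΘ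
    (fun g hg t ht t' ht' hne => by
      have hw := sq_cfDen_le_cfWedge (h.ne_nil_of_mem hg) (h.letters_left g hg)
        (h.letters_block _ t ht) (h.letters_block _ t' ht') (hTU _ ht _ ht') hne
      have p1 := one_le_cfDen (h.pos_left _ _ g hg)
      have p2 := one_le_cfDen (h.pos_block _ t ht)
      have p3 := hs.le_u g hg t ht
      have p4 := cfDen_append_le (h.pos_left _ _ g hg) (h.pos_block _ t ht)
      have p5 := h.blocks.cfDen_blockCat_le h.zero_notMem _ t ht
      rw [sum_map_reverse] at p5
      have e := two_mul_sum_seg_add_two (20 * i) i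
      set S := ((seg (20 * i) i).map (· + 2)).sum
      set W := |cfWedge (g ++ t) (g ++ t')|
      have q1 : (((cfDen u₀).toNat : ℕ) : ℤ) ≤ 18 * (cfDen g * (X : ℤ) ^ S) := by
        have : cfDen g * cfDen t ≤ cfDen g * (X : ℤ) ^ S :=
          mul_le_mul_of_nonneg_left p5 (by linarith)
        linarith
      have hX : 13200 * ((α : ℤ) + 1) ≤ X := by exact_mod_cast h.le_X
      have hα : (0 : ℤ) ≤ α := by positivity
      have hX0 : (0 : ℤ) < X := by linarith
      have q2 : (((cfDen u₀).toNat : ℕ) : ℤ) ^ 2 ≤ (18 * (cfDen g * (X : ℤ) ^ S)) ^ 2 :=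
        pow_le_pow_left₀ (by positivity) q1 2
      have q3 : (0 : ℤ) < W := by
        have : 0 < cfDen g ^ 2 := by positivity
        nlinarith
      have q4 : ((X : ℤ) ^ S) ^ 2 * X ≤ (X : ℤ) ^ (66 * j ^ 2) := by
        rw [← pow_mul, ← pow_succ]
        refine pow_le_pow_right₀ (by linarith) ?_
        rw [hi] at e
        nlinarith
      set D := (X : ℤ) ^ S
      have hD : 0 < D := by positivity
      push_cast
      calc 81 * (((cfDen u₀).toNat : ℕ) : ℤ) ^ 2 ≤ 81 * (18 * (cfDen g * D)) ^ 2 := by linarith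
        _ = 26244 * (D ^ 2 * cfDen g ^ 2) := by ring
        _ ≤ 26244 * (D ^ 2 * ((α + 1) * W)) := by gcongr
        _ = D ^ 2 * W * (26244 * ((α : ℤ) + 1)) := by ring
        _ < D ^ 2 * W * (2 * X) := by
            apply mul_lt_mul_of_pos_left (by linarith) (by positivity)
        _ = 2 * ((D ^ 2 * X) * W) := by ring
        _ ≤ 2 * ((X : ℤ) ^ (66 * j ^ 2) * W) := by gcongr)
  have hsave := large_sieve_saving (X := X) (l := (cfDen v₀).toNat) (a := 10 * i * (20 * i + 3))
    (i := i) (g := G.card) (T := T.card) (V := V.card) h.one_le_X (by positivity) (by positivity)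
    (h.le_of_mem_right (by nlinarith) hv₀) (h.blocks.card_blockCat _) (h.blocks.card_blockCat _) (by
      have e1 := two_mul_sum_seg_add_one (20 * i) i
      have e2 := two_mul_sum_range_add_one (20 * i)
      rw [sum_map_reverse, sum_map_reverse]
      nlinarith)
  have hexp : ∀ b : ZMod (81 * (cfDen (u₀ ++ v₀)).toNat), expSum (ens B I f) b =
      ∑ g ∈ G, ∑ t ∈ T, ∑ v ∈ V, (ZMod.stdAddChar
        (b * (cfDen (g ++ t ++ v) : ZMod (81 * (cfDen (u₀ ++ v₀)).toNat))) : ℂ) := fun b => by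
    rw [hΩ, expSum_cat_cat hGU hTU]
  have hcard : ((ens B I f).card : ℝ) = G.card * T.card * V.card := by
    rw [hΩ, card_cat (hGU.cat hTU), card_cat hGU]; push_cast; ring
  simp only [hexp, hcard]
  exact hsum.trans hsave

theorem sum_minor (h : IsEnsemble A X α I B f w₀) {P : ℕ} [NeZero P]
    (hP : P = 81 * (cfDen w₀).toNat) (Θ : Finset (ZMod P))
    (hΘ : ∀ b ∈ Θ, ¬ App P (X ^ (66 * I ^ 2)) b) :
    ∑ b ∈ Θ, ‖expSum (ens B I f) b‖ ^ 2 ≤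
      1024 * 43 * 81 * (1 / X) ^ I * ((ens B I f).card : ℝ) ^ 2 := by
  have hI := h.le_I
  set T := blockCat B (List.range (7 * I)) with hT
  set V := blockCat B (List.range (21 * I)).reverse with hV
  have hΩ : ens B I f = cat (cat T {f}) V := by rw [ens, cat_assoc]
  obtain ⟨u₀, hu₀, v₀, hv₀, rfl⟩ := mem_cat.1 (hΩ ▸ h.w₀_mem)
  subst hP
  have hTU : Uniform T := h.blocks.uniform_blockCat _
  have hVU : Uniform V := h.blocks.uniform_blockCat _
  have hL : ∀ w ∈ cat T {f}, ∀ d ∈ w, 1 ≤ d := letters_cat (h.pos_block _) h.pos_f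
  have hpin : Pinned 9 (cat T {f}) := by
    have h1 := h.pinned_block 0 (7 * I)
    rw [seg_zero] at h1
    exact (Pinned.cat (by norm_num) h1 (pinned_singleton f) (h.pos_block _) h.pos_f).mono
      (by norm_num) hL
  have hs : IsSplit (81 * (cfDen (u₀ ++ v₀)).toNat) (cfDen u₀).toNat (cfDen v₀).toNat {f} T V
      (fun g t => t ++ g) :=
    isSplit_of_mem hpin (h.pinned_right _) hL (h.pos_block _) hVU hu₀ hv₀
      fun g hg t ht => mem_cat.2 ⟨t, ht, g, hg, rfl⟩
  have e := two_mul_sum_range_add_two (7 * I)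
  set S := ((List.range (7 * I)).map (· + 2)).sum with hS
  have hm : (cfDen u₀).toNat ≤ 2 * X ^ (S + I ^ 2) := by
    obtain ⟨t, ht, g, hg, rfl⟩ := mem_cat.1 hu₀
    rw [Finset.mem_singleton.1 hg]
    have p1 := cfDen_append_le (h.pos_block _ t ht) (h.pos_f f (by simp))
    have p2 := h.blocks.cfDen_blockCat_le h.zero_notMem _ t ht
    have p3 := mul_le_mul p2 h.f_le (zero_le_one.trans (one_le_cfDen (h.pos_f f (by simp))))
      (by positivity)
    rw [Int.toNat_le]
    push_cast
    rw [pow_add]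
    linarith
  have hX : 13200 ≤ X := by have := h.le_X; omega
  have hsum := hs.minor (Z := X ^ (66 * I ^ 2)) (by
      have e2 := two_mul_sum_range_add_one (21 * I)
      have p1 := h.ge_of_mem_right e2.le hv₀
      have p2 : X ^ (S + I ^ 2) ≤ X ^ ((List.range (21 * I)).map (· + 1)).sum :=
        Nat.pow_le_pow_right h.one_le_X (by nlinarith)
      have p3 : 0 < X ^ (S + I ^ 2) := by positivity
      omega) (by
      have p1 : (cfDen u₀).toNat ^ 2 ≤ (2 * X ^ (S + I ^ 2)) ^ 2 := Nat.pow_le_pow_left hm 2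
      have p2 : (X ^ (S + I ^ 2)) ^ 2 * X ≤ X ^ (66 * I ^ 2) := by
        rw [← pow_mul, ← pow_succ]
        exact Nat.pow_le_pow_right h.one_le_X (by nlinarith)
      have p3 : (X ^ (S + I ^ 2)) ^ 2 * 13200 ≤ (X ^ (S + I ^ 2)) ^ 2 * X :=
        Nat.mul_le_mul_left _ hX
      rw [mul_pow] at p1
      omega) Θ hΘ
    (fun g hg t ht t' ht' hne => by
      rw [← abs_pos, abs_cfWedge_append, abs_pos]
      exact cfWedge_ne_zero (h.pos_block _ _ ht) (h.pos_block _ _ ht') (hTU _ ht _ ht') hne)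
    (fun g hg t ht t' ht' => by
      rw [abs_cfWedge_append]
      have h1 := abs_cfWedge_le (h.pos_block _ _ ht) (h.pos_block _ _ ht')
        (h.le_of_mem_left e.ge ht) (h.le_of_mem_left e.ge ht')
      refine h1.trans ?_
      have h2 : (X ^ S) ^ 2 ≤ X ^ (66 * I ^ 2) := by
        rw [← pow_mul]
        exact Nat.pow_le_pow_right h.one_le_X (by nlinarith)
      exact_mod_cast h2)
  have e3 := two_mul_sum_range_add_two (21 * I)
  have hsave := large_sieve_saving (X := X) (l := (cfDen v₀).toNat)
    (i := I) (g := ({f} : Finset (List ℕ)).card) (T := T.card) (V := V.card) h.one_le_X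
    (by positivity) (by positivity)
    (h.le_of_mem_right e3.ge hv₀) (h.blocks.card_blockCat _) (h.blocks.card_blockCat _) (by
      have e1 := two_mul_sum_range_add_one (7 * I)
      have e2 := two_mul_sum_range_add_one (21 * I)
      rw [sum_map_reverse]
      nlinarith)
  have hexp : ∀ b : ZMod (81 * (cfDen (u₀ ++ v₀)).toNat), expSum (ens B I f) b =
      ∑ g ∈ {f}, ∑ t ∈ T, ∑ v ∈ V, (ZMod.stdAddChar
        (b * (cfDen (t ++ g ++ v) : ZMod (81 * (cfDen (u₀ ++ v₀)).toNat))) : ℂ) := fun b => by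
    rw [hΩ, expSum_cat_cat hTU (uniform_singleton f), Finset.sum_comm]
  have hcard : ((ens B I f).card : ℝ) = ({f} : Finset (List ℕ)).card * T.card * V.card := by
    rw [hΩ, card_cat (hTU.cat (uniform_singleton f)), card_cat hTU]; push_cast; ring
  simp only [hexp, hcard]
  exact hsum.trans hsave

end IsEnsemble

open ZMod in
/-- A set of words whose exponential sums are small in mean square has many denominators. -/
theorem le_card_image_cfDen {P : ℕ} [NeZero P] {Ω : Finset (List ℕ)} (hΩ : Ω.Nonempty) {C : ℝ}
    (h : ∑ b : ZMod P, ‖expSum Ω b‖ ^ 2 ≤ C * (Ω.card : ℝ) ^ 2) :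
    (P : ℝ) ≤ C * (Ω.image cfDen).card := by
  classical
  set g : List ℕ → ZMod P := fun w => (cfDen w : ZMod P)
  set r : ZMod P → ℕ := fun z => (Ω.filter fun w => g w = z).card
  have h1 : ∀ b : ZMod P, expSum Ω b = ∑ z, (r z : ℂ) * stdAddChar (z * b) := by
    intro b
    rw [expSum, ← Finset.sum_fiberwise Ω g]
    refine Finset.sum_congr rfl fun z _ => ?_
    rw [← nsmul_eq_mul]
    refine Finset.sum_eq_card_nsmul fun w hw => ?_
    rw [← (Finset.mem_filter.1 hw).2, mul_comm]
  have h2 : (P : ℝ) * ∑ z, (r z : ℝ) ^ 2 ≤ C * (Ω.card : ℝ) ^ 2 := by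
    simp only [h1] at h
    rw [sum_norm_sq_sum_stdAddChar] at h
    simpa using h
  have h3 : ((Ω.card : ℕ) : ℝ) = ∑ z ∈ Ω.image g, (r z : ℝ) := by
    rw [Finset.card_eq_sum_card_image g Ω]; push_cast; rfl
  have h4 : (Ω.card : ℝ) ^ 2 ≤ (Ω.image g).card * ∑ z, (r z : ℝ) ^ 2 := by
    rw [h3]
    refine sq_sum_le_card_mul_sum_sq.trans ?_
    gcongr
    exact Finset.subset_univ _
  have h5 : (Ω.image g).card ≤ (Ω.image cfDen).card := by
    have : Ω.image g = (Ω.image cfDen).image (fun n : ℤ => (n : ZMod P)) := by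
      rw [Finset.image_image]; rfl
    rw [this]
    exact Finset.card_image_le
  have h6 : (0 : ℝ) < Ω.card := by exact_mod_cast hΩ.card_pos
  have hP : (0 : ℝ) < P := by exact_mod_cast NeZero.pos P
  have h9 : (0 : ℝ) ≤ ∑ z, (r z : ℝ) ^ 2 := Finset.sum_nonneg fun z _ => sq_nonneg _
  generalize ∑ z, (r z : ℝ) ^ 2 = s at h2 h4 h9
  have h10 : (0 : ℝ) < (Ω.card : ℝ) ^ 2 := pow_pos h6 2
  have hC : 0 ≤ C := nonneg_of_mul_nonneg_left ((mul_nonneg hP.le h9).trans h2) h10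
  have h7 : (P : ℝ) * (Ω.card : ℝ) ^ 2 ≤ C * (Ω.image g).card * (Ω.card : ℝ) ^ 2 :=
    calc (P : ℝ) * (Ω.card : ℝ) ^ 2 ≤ P * ((Ω.image g).card * s) :=
          mul_le_mul_of_nonneg_left h4 hP.le
      _ = (Ω.image g).card * (P * s) := by ring
      _ ≤ (Ω.image g).card * (C * (Ω.card : ℝ) ^ 2) :=
          mul_le_mul_of_nonneg_left h2 (Nat.cast_nonneg _)
      _ = _ := by ring
  exact (le_of_mul_le_mul_right h7 h10).trans
    (mul_le_mul_of_nonneg_left (Nat.cast_le.2 h5) hC)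

theorem norm_expSum_le {P : ℕ} [NeZero P] (Ω : Finset (List ℕ)) (b : ZMod P) :
    ‖expSum Ω b‖ ≤ Ω.card := by
  refine (norm_sum_le _ _).trans ?_
  simp

theorem sum_half_pow_le {X : ℝ} (hX : 2 ≤ X) (a b : ℕ) :
    ∑ j ∈ Finset.Ico a b, (1 / X) ^ (j + 1) ≤ 1 := by
  have h : ∀ n : ℕ, ∑ j ∈ Finset.range n, (1 / 2 : ℝ) ^ (j + 1) = 1 - (1 / 2) ^ n := fun n => by
    induction n with
    | zero => simp
    | succ n ih => rw [Finset.sum_range_succ, ih, pow_succ]; ring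
  calc ∑ j ∈ Finset.Ico a b, (1 / X) ^ (j + 1) ≤ ∑ j ∈ Finset.range b, (1 / X) ^ (j + 1) :=
        Finset.sum_le_sum_of_subset_of_nonneg (by intro j; simp) fun _ _ _ => by positivity
    _ ≤ ∑ j ∈ Finset.range b, (1 / 2 : ℝ) ^ (j + 1) := by gcongr
    _ ≤ 1 := by rw [h]; have : (0 : ℝ) < (1 / 2) ^ b := by positivity
                linarith

/-- The number of residues with an approximation of quality `Z` is at most this. -/
def appBound (Z : ℕ) : ℕ := (Z + 1) * (2 * (Z * (Z + 1)) + 1) * (2 * (Z * Z) + 1)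

namespace IsEnsemble

variable {A : Finset ℕ} {X α I : ℕ} {B : ℕ → Finset (List ℕ)} {f w₀ : List ℕ}

open Classical in
theorem sum_norm_sq_expSum_le (h : IsEnsemble A X α I B f w₀) {P : ℕ} [NeZero P]
    (hP : P = 81 * (cfDen w₀).toNat) :
    ∑ b : ZMod P, ‖expSum (ens B I f) b‖ ^ 2 ≤
      (appBound (X ^ (66 * 100 ^ 2)) + 3 * (1024 * 43 * 81)) * ((ens B I f).card : ℝ) ^ 2 := by
  set Z : ℕ → ℕ := fun j => X ^ (66 * j ^ 2) with hZ
  set S : ZMod P → ℝ := fun b => ‖expSum (ens B I f) b‖ ^ 2 with hS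
  set Q : ℕ → ZMod P → Prop := fun j b => ∃ q a : ℤ, 1 ≤ q ∧ q ≤ (Z (j + 1) : ℕ) ∧ IsCoprime a q ∧
      |(b.val : ℤ) * q - a * P| ≤ (Z (j + 1) : ℕ) * q ∧ (Z j : ℕ) < q with hQ
  set R : ℕ → ZMod P → Prop := fun j b => ∃ q a : ℤ, 1 ≤ q ∧ q ≤ (Z (j + 1) : ℕ) ∧ IsCoprime a q ∧
      |(b.val : ℤ) * q - a * P| ≤ (Z (j + 1) : ℕ) * q ∧
      (Z j : ℕ) * q < |(b.val : ℤ) * q - a * P| with hR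
  have hS0 : ∀ b, 0 ≤ S b := fun b => by positivity
  have hpt : ∀ b, S b ≤
      (if App P (Z 100) b then S b else 0) + (if ¬ App P (Z I) b then S b else 0) +
      ∑ j ∈ Finset.Ico 100 I, ((if Q j b then S b else 0) + (if R j b then S b else 0)) := by
    intro b
    have n1 : 0 ≤ if App P (Z 100) b then S b else 0 := by split_ifs <;> simp [hS0]
    have n2 : 0 ≤ if ¬ App P (Z I) b then S b else 0 := by split_ifs <;> simp [hS0]
    have n3 : ∀ j, 0 ≤ if Q j b then S b else 0 := fun j => by split_ifs <;> simp [hS0]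
    have n4 : ∀ j, 0 ≤ if R j b then S b else 0 := fun j => by split_ifs <;> simp [hS0]
    have n5 : 0 ≤
        ∑ j ∈ Finset.Ico 100 I, ((if Q j b then S b else 0) + (if R j b then S b else 0)) :=
      Finset.sum_nonneg fun j _ => add_nonneg (n3 j) (n4 j)
    by_cases c1 : App P (Z 100) b
    · rw [if_pos c1] at n1 ⊢; linarith
    by_cases c2 : App P (Z I) b
    · obtain ⟨j, hj1, hj2, hj3, hj4⟩ : ∃ j, 100 ≤ j ∧ j < I ∧ ¬ App P (Z j) b ∧
          App P (Z (j + 1)) b := by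
        by_contra! hn
        have : ∀ j, 100 ≤ j → j ≤ I → ¬ App P (Z j) b := by
          intro j hj
          induction j, hj using Nat.le_induction with
          | base => exact fun _ => c1
          | succ j hj ih => exact fun hjI => hn j hj (by omega) (ih (by omega))
        exact this I h.le_I le_rfl c2
      have hQR : Q j b ∨ R j b := by
        obtain ⟨q, a, k1, k2, k3, k4⟩ := hj4
        by_contra hn
        rw [not_or] at hn
        refine hj3 ⟨q, a, k1, ?_, k3, ?_⟩
        · by_contra hc
          exact hn.1 ⟨q, a, k1, k2, k3, k4, not_le.1 hc⟩
        · by_contra hc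
          exact hn.2 ⟨q, a, k1, k2, k3, k4, not_le.1 hc⟩
      have hle := Finset.single_le_sum (f := fun j => ((if Q j b then S b else 0) +
        (if R j b then S b else 0))) (fun j _ => add_nonneg (n3 j) (n4 j))
        (Finset.mem_Ico.2 ⟨hj1, hj2⟩)
      have : S b ≤ (if Q j b then S b else 0) + (if R j b then S b else 0) := by
        rcases hQR with hq | hq
        · rw [if_pos hq]; linarith [n4 j]
        · rw [if_pos hq]; linarith [n3 j]
      linarith
    · have : (if ¬ App P (Z I) b then S b else 0) = S b := if_pos c2
      linarith
  have hX2 : (2 : ℝ) ≤ X := by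
    have : 2 ≤ X := by have := h.le_X; omega
    exact_mod_cast this
  set N := ((ens B I f).card : ℝ) ^ 2 with hN
  have hN0 : 0 ≤ N := by positivity
  have b1 : ∑ b, (if App P (Z 100) b then S b else 0) ≤ appBound (Z 100) * N := by
    rw [← Finset.sum_filter]
    calc _ ≤ ∑ b ∈ Finset.univ.filter (fun b => App P (Z 100) b), N :=
          Finset.sum_le_sum fun b _ => pow_le_pow_left₀ (norm_nonneg _) (norm_expSum_le _ b) 2
      _ ≤ _ := by
          rw [Finset.sum_const, nsmul_eq_mul]
          gcongr
          exact card_app_le _ fun b hb => (Finset.mem_filter.1 hb).2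
  have b2 : ∑ b, (if ¬ App P (Z I) b then S b else 0) ≤ 1024 * 43 * 81 * N := by
    rw [← Finset.sum_filter]
    refine (h.sum_minor hP _ fun b hb => (Finset.mem_filter.1 hb).2).trans ?_
    have : ((1 : ℝ) / X) ^ I ≤ 1 :=
      pow_le_one₀ (by positivity) (by rw [div_le_one (by linarith)]; linarith)
    nlinarith
  have b3 : ∑ b, ∑ j ∈ Finset.Ico 100 I, ((if Q j b then S b else 0) + (if R j b then S b else 0)) ≤
      2 * (1024 * 43 * 81) * N := by
    rw [Finset.sum_comm]
    calc _ ≤ ∑ j ∈ Finset.Ico 100 I, 2 * (1024 * 43 * 81) * N * (1 / (X : ℝ)) ^ (j + 1) := by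
          refine Finset.sum_le_sum fun j hj => ?_
          obtain ⟨hj1, hj2⟩ := Finset.mem_Ico.1 hj
          rw [Finset.sum_add_distrib, ← Finset.sum_filter, ← Finset.sum_filter]
          have c1 := h.sum_large_denominator hP (by omega) hj2 (Finset.univ.filter (Q j))
            fun b hb => (Finset.mem_filter.1 hb).2
          have c2 := h.sum_large_remainder hP (by omega) hj2 (Finset.univ.filter (R j))
            fun b hb => (Finset.mem_filter.1 hb).2
          linarith
      _ ≤ _ := by
          rw [← Finset.mul_sum]
          have := sum_half_pow_le hX2 100 I
          have h0 : 0 ≤ 2 * (1024 * 43 * 81) * N := by positivity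
          nlinarith
  calc ∑ b, S b ≤ _ := Finset.sum_le_sum fun b _ => hpt b
    _ ≤ _ := by
      rw [Finset.sum_add_distrib, Finset.sum_add_distrib]
      linarith

theorem cfDen_le_of_mem (h : IsEnsemble A X α I B f w₀) {w : List ℕ} (hw : w ∈ ens B I f) :
    cfDen w ≤ 9 * cfDen w₀ := by
  have h1 := h.pinned_left 0 (21 * I)
  rw [seg_zero] at h1
  have h2 := h1 w hw w₀ h.w₀_mem 1 1
  exact_mod_cast h2

theorem cfDen_le_card_image (h : IsEnsemble A X α I B f w₀) :
    (cfDen w₀ : ℝ) ≤ (appBound (X ^ (66 * 100 ^ 2)) + 3 * (1024 * 43 * 81)) *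
      ((ens B I f).image cfDen).card := by
  have h1 : 1 ≤ cfDen w₀ := one_le_cfDen (h.pos_left _ _ w₀ h.w₀_mem)
  have : NeZero (81 * (cfDen w₀).toNat) := ⟨by omega⟩
  have h2 := le_card_image_cfDen ⟨w₀, h.w₀_mem⟩ (h.sum_norm_sq_expSum_le rfl)
  have h3 : (((cfDen w₀).toNat : ℕ) : ℝ) = cfDen w₀ := by
    exact_mod_cast Int.toNat_of_nonneg (by omega : 0 ≤ cfDen w₀)
  push_cast at h2
  have h4 : (1 : ℝ) ≤ cfDen w₀ := by exact_mod_cast h1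
  rw [h3] at h2
  push_cast
  linarith

end IsEnsemble

/-! ### Counting words from the Hausdorff dimension -/

theorem two_pow_le_cfDen : ∀ {l : List ℕ}, (∀ d ∈ l, 1 ≤ d) → (2 : ℤ) ^ (l.length / 2) ≤ cfDen l
  | [], _ => by simp [cfDen, cfMat]
  | [a], h => by
    have := h a (by simp)
    simp [cfDen, cfMat]; omega
  | a :: b :: l, h => by
    have hl : ∀ d ∈ l, 1 ≤ d := fun d hd => h d (by simp [hd])
    have ih := two_pow_le_cfDen hl
    have ha : (1 : ℤ) ≤ a := by exact_mod_cast h a (by simp)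
    have hb : (1 : ℤ) ≤ b := by exact_mod_cast h b (by simp)
    have h1 := cfMat_nonneg hl 0 1
    have h2 := one_le_cfDen hl
    have e : (a :: b :: l).length / 2 = l.length / 2 + 1 := by simp only [List.length_cons]; omega
    rw [e, pow_succ, cfDen, cfMat_cons_one, cfMat_cons_zero, cfMat_cons_one]
    rw [cfDen] at ih h2
    have h3 : cfMat l 1 1 ≤ b * cfMat l 1 1 := by nlinarith
    have h4 : cfMat l 0 1 + b * cfMat l 1 1 ≤ a * (cfMat l 0 1 + b * cfMat l 1 1) := by nlinarith
    linarith

theorem length_le_of_cfDen_le {l : List ℕ} (h : ∀ d ∈ l, 1 ≤ d) {N : ℕ} (hN : cfDen l ≤ N) :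
    l.length ≤ 2 * Nat.log 2 N + 1 := by
  have h1 := (two_pow_le_cfDen h).trans hN
  have h2 : 2 ^ (l.length / 2) ≤ N := by exact_mod_cast h1
  have h3 := Nat.le_log_of_pow_le (by norm_num) h2
  omega

/-- The words over `A` with denominator between `Y` and `(α + 1) Y`. -/
def wordsBetween (A : Finset ℕ) (α Y : ℕ) : Set (List ℕ) :=
  {w | (∀ d ∈ w, d ∈ A) ∧ (Y : ℤ) ≤ cfDen w ∧ cfDen w ≤ ((α + 1) * Y : ℕ)}

theorem finite_wordsBetween {A : Finset ℕ} (hA : 0 ∉ A) (α Y : ℕ) :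
    (wordsBetween A α Y).Finite := by
  refine ((List.finite_length_le A (2 * Nat.log 2 ((α + 1) * Y) + 1)).image
    (List.map Subtype.val)).subset ?_
  rintro w ⟨h1, -, h2⟩
  have h3 := length_le_of_cfDen_le (fun d hd => Nat.pos_of_ne_zero fun h => hA (h ▸ h1 d hd)) h2
  lift w to List A using h1
  exact ⟨w, by simpa using h3, rfl⟩

/-- The interval of numbers whose expansion starts with the word. -/
def cylinder (w : List ℕ) : Set ℝ :=
  {x | ∃ y : ℝ, 0 ≤ y ∧ x * (cfMat w 1 1 + cfMat w 1 0 * y) = cfMat w 0 1 + cfMat w 0 0 * y ∧ y ≤ 1}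

theorem dist_le_of_mem_cylinder {w : List ℕ} (hw : ∀ d ∈ w, 1 ≤ d) {Y : ℕ} (hY : 1 ≤ Y)
    (hYw : (Y : ℤ) ≤ cfDen w) {x x' : ℝ} (hx : x ∈ cylinder w) (hx' : x' ∈ cylinder w) :
    dist x x' ≤ 1 / (Y : ℝ) ^ 2 := by
  obtain ⟨y, h0, h1, h2⟩ := hx
  obtain ⟨y', h0', h1', h2'⟩ := hx'
  have hY' : (1 : ℝ) ≤ Y := by exact_mod_cast hY
  have hd : (Y : ℝ) ≤ cfMat w 1 1 := by exact_mod_cast hYw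
  have hn : (0 : ℝ) ≤ cfMat w 1 0 := by exact_mod_cast cfMat_nonneg hw 1 0
  have hdet : ((cfMat w 0 0 : ℝ) * cfMat w 1 1 - cfMat w 0 1 * cfMat w 1 0) ^ 2 = 1 := by
    have := cfMat_det w
    have h : (cfMat w 0 0 * cfMat w 1 1 - cfMat w 0 1 * cfMat w 1 0) ^ 2 = 1 := by
      rw [this, ← pow_mul, mul_comm, pow_mul]; simp
    exact_mod_cast h
  set D := (cfMat w 1 1 : ℝ) + cfMat w 1 0 * y
  set D' := (cfMat w 1 1 : ℝ) + cfMat w 1 0 * y'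
  have hD : (Y : ℝ) ≤ D := by nlinarith
  have hD' : (Y : ℝ) ≤ D' := by nlinarith
  have hDD : (Y : ℝ) ^ 2 ≤ D * D' := by nlinarith
  have key : ((x - x') * (D * D')) ^ 2 = (y - y') ^ 2 := by
    have : (x - x') * (D * D') =
        ((cfMat w 0 0 : ℝ) * cfMat w 1 1 - cfMat w 0 1 * cfMat w 1 0) * (y - y') := by
      calc _ = (x * D) * D' - (x' * D') * D := by ring
        _ = _ := by rw [h1, h1']; ring
    rw [this, mul_pow, hdet, one_mul]
  have h3 : |(x - x') * (D * D')| ≤ 1 := by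
    rw [← Real.sqrt_sq_eq_abs, key, Real.sqrt_sq_eq_abs, abs_le]
    constructor <;> linarith
  rw [abs_mul, abs_of_nonneg (by nlinarith : 0 ≤ D * D')] at h3
  rw [Real.dist_eq, le_div_iff₀ (by positivity)]
  exact (mul_le_mul_of_nonneg_left hDD (abs_nonneg _)).trans h3

section covering

variable {A : Finset ℕ} {α : ℕ} {x : ℝ}

/-- The first partial quotients. -/
noncomputable def digits (x : ℝ) (n : ℕ) : List ℕ :=
  (List.range n).map fun k => ⌊1 / gaussIter x k⌋₊

theorem digits_succ (x : ℝ) (n : ℕ) : digits x (n + 1) = digits x n ++ [⌊1 / gaussIter x n⌋₊] := by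
  simp [digits, List.range_succ]

theorem digits_mem (hx : x ∈ Eset A) (n : ℕ) : ∀ d ∈ digits x n, d ∈ A := by
  intro d hd
  obtain ⟨k, -, rfl⟩ := List.mem_map.1 hd
  exact hx.2.2 k

theorem gaussIter_pos (hA : 0 ∉ A) (hx : x ∈ Eset A) (n : ℕ) : 0 < gaussIter x n := by
  by_contra h
  have h1 : ⌊1 / gaussIter x n⌋₊ = 0 :=
    Nat.floor_of_nonpos (one_div_nonpos.2 (not_lt.1 h))
  exact hA (h1 ▸ hx.2.2 n)

theorem gaussIter_le_one (hx : x ∈ Eset A) (n : ℕ) : gaussIter x n ≤ 1 := by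
  cases n with
  | zero => exact hx.1.2.le
  | succ n => rw [gaussIter]; linarith [Nat.lt_floor_add_one (1 / gaussIter x n)]

theorem mem_cylinder_digits (hA : 0 ∉ A) (hx : x ∈ Eset A) (n : ℕ) :
    x ∈ cylinder (digits x n) := by
  refine ⟨gaussIter x n, (gaussIter_pos hA hx n).le, ?_, gaussIter_le_one hx n⟩
  induction n with
  | zero => simp [digits, cfMat, gaussIter]
  | succ n ih =>
    have h0 := gaussIter_pos hA hx n
    rw [digits_succ, cfMat_concat_one, cfMat_concat_one, cfMat_concat_zero, cfMat_concat_zero,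
      gaussIter]
    push_cast
    have h1 : gaussIter x n * (1 / gaussIter x n) = 1 := by field_simp
    refine mul_left_cancel₀ h0.ne' ?_
    linear_combination ih + (x * cfMat (digits x n) 1 1 - cfMat (digits x n) 0 1) * h1

theorem exists_mem_cylinder (hA : 0 ∉ A) (hα : ∀ d ∈ A, d ≤ α) (hx : x ∈ Eset A) {Y : ℕ}
    (hY : 2 ≤ Y) : ∃ w ∈ wordsBetween A α Y, x ∈ cylinder w := by
  classical
  have hpos : ∀ n, ∀ d ∈ digits x n, 1 ≤ d := fun n d hd =>
    Nat.pos_of_ne_zero fun h => hA (h ▸ digits_mem hx n d hd)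
  have hex : ∃ n, (Y : ℤ) ≤ cfDen (digits x n) := by
    refine ⟨2 * Y, ?_⟩
    have h := (Nat.lt_two_pow_self (n := Y)).le
    have h1 := two_pow_le_cfDen (hpos (2 * Y))
    have h2 : (digits x (2 * Y)).length / 2 = Y := by simp [digits]
    rw [h2] at h1
    exact le_trans (by exact_mod_cast h) h1
  obtain ⟨n, hn, hmin⟩ : ∃ n, (Y : ℤ) ≤ cfDen (digits x n) ∧
      ∀ m < n, ¬ (Y : ℤ) ≤ cfDen (digits x m) :=
    ⟨Nat.find hex, Nat.find_spec hex, fun m hm => Nat.find_min hex hm⟩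
  refine ⟨digits x n, ⟨digits_mem hx n, hn, ?_⟩, mem_cylinder_digits hA hx n⟩
  rcases n with _ | n
  · simp [digits, cfDen, cfMat] at hn
    omega
  · have h1 := not_le.1 (hmin n (Nat.lt_succ_self n))
    have h2 := cfMat_le_cfDen (hpos n) 1 0
    have h3 : ((⌊1 / gaussIter x n⌋₊ : ℕ) : ℤ) ≤ α := by exact_mod_cast hα _ (hx.2.2 n)
    have h4 := one_le_cfDen (hpos n)
    rw [digits_succ, cfDen, cfMat_concat_one]
    rw [cfDen] at h1 h2 h4
    push_cast
    have h5 := mul_le_mul_of_nonneg_right h3 (by linarith : 0 ≤ cfMat (digits x n) 1 1)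
    have h6 : (α : ℤ) * cfMat (digits x n) 1 1 ≤ α * Y :=
      mul_le_mul_of_nonneg_left h1.le (by positivity)
    linarith

end covering

open MeasureTheory Filter Topology in
theorem eventually_le_ncard_wordsBetween {A : Finset ℕ} (hA : 0 ∉ A) {α : ℕ}
    (hα : ∀ d ∈ A, d ≤ α) {s : NNReal} (hs : (s : ENNReal) < dimH (Eset A)) :
    ∀ᶠ Y : ℕ in atTop, (Y : ℝ) ^ (2 * s : ℝ) ≤ (wordsBetween A α Y).ncard := by
  by_contra hcon
  rw [not_eventually] at hcon
  have h0 := hausdorffMeasure_of_lt_dimH hs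
  let _ : ∀ Y, Fintype (wordsBetween A α Y) := fun Y => (finite_wordsBetween hA α Y).fintype
  have hpos : ∀ {Y : ℕ} {w : List ℕ}, w ∈ wordsBetween A α Y → ∀ d ∈ w, 1 ≤ d := fun hw d hd =>
    Nat.pos_of_ne_zero fun h => hA (h ▸ hw.1 d hd)
  have hdiam : ∀ Y : ℕ, 1 ≤ Y → ∀ w : wordsBetween A α Y,
      Metric.ediam (cylinder w.1) ≤ ENNReal.ofReal (1 / (Y : ℝ) ^ 2) := fun Y hY w =>
    Metric.ediam_le_of_forall_dist_le fun x hx x' hx' =>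
      dist_le_of_mem_cylinder (hpos w.2) hY w.2.2.1 hx hx'
  have h1 := Measure.hausdorffMeasure_le_liminf_sum (s : ℝ) (Eset A) (l := atTop)
    (fun Y : ℕ => ENNReal.ofReal (1 / (Y : ℝ) ^ 2)) (by
      rw [← ENNReal.ofReal_zero]
      refine ENNReal.tendsto_ofReal ?_
      have := (tendsto_inv_atTop_nhds_zero_nat (𝕜 := ℝ)).pow 2
      simpa using this)
    (fun Y (w : wordsBetween A α Y) => cylinder w.1)
    (by filter_upwards [eventually_ge_atTop 1] with Y hY using hdiam Y hY)
    (by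
      filter_upwards [eventually_ge_atTop 2] with Y hY x hx
      obtain ⟨w, hw, hxw⟩ := exists_mem_cylinder hA hα hx hY
      exact Set.mem_iUnion.2 ⟨⟨w, hw⟩, hxw⟩)
  rw [h0, top_le_iff] at h1
  refine absurd h1 (ne_top_of_le_ne_top ENNReal.one_ne_top (liminf_le_of_frequently_le' ?_))
  refine (hcon.and_eventually (eventually_ge_atTop 1)).mono fun Y ⟨hY, hY1⟩ => ?_
  have hY0 : (0 : ℝ) < Y := by exact_mod_cast hY1
  calc ∑ w : wordsBetween A α Y, Metric.ediam (cylinder w.1) ^ (s : ℝ)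
      ≤ ∑ w : wordsBetween A α Y, ENNReal.ofReal (1 / (Y : ℝ) ^ 2) ^ (s : ℝ) :=
        Finset.sum_le_sum fun w _ => ENNReal.rpow_le_rpow (hdiam Y hY1 w) s.2
    _ = ENNReal.ofReal ((wordsBetween A α Y).ncard * (1 / (Y : ℝ) ^ (2 * s : ℝ))) := by
        rw [Finset.sum_const, Finset.card_univ, ← Nat.card_eq_fintype_card, nsmul_eq_mul,
          ENNReal.ofReal_rpow_of_pos (by positivity), ENNReal.ofReal_mul (by positivity),
          ENNReal.ofReal_natCast]
        congr 2
        rw [Real.div_rpow (by positivity) (by positivity), Real.one_rpow, Real.rpow_mul hY0.le]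
        norm_num
    _ ≤ 1 := by
        rw [ENNReal.ofReal_le_one, mul_one_div, div_le_one (by positivity)]
        exact (not_le.1 hY).le

theorem coe_lt_of_ofReal_lt {a : ENNReal}
    (h : ENNReal.ofReal (1 - 1 / (8 + Real.sqrt 34)) < a) :
    ((927 / 1000 : NNReal) : ENNReal) < a := by
  refine lt_of_le_of_lt ?_ h
  have h1 : (5.83 : ℝ) ≤ Real.sqrt 34 := Real.le_sqrt_of_sq_le (by norm_num)
  have h2 : 1 / (8 + Real.sqrt 34) ≤ 73 / 1000 := by
    rw [div_le_iff₀ (by linarith)]; linarith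
  rw [← ENNReal.ofReal_coe_nnreal]
  refine ENNReal.ofReal_le_ofReal ?_
  push_cast
  linarith

/-! ### Blocks -/

theorem le_mul_of_floor_log_eq {x y η : ℝ} (hη : 0 < η) (hx : 1 ≤ x) (hy : 1 ≤ y)
    (h : ⌊Real.log x / Real.log (1 + η)⌋₊ = ⌊Real.log y / Real.log (1 + η)⌋₊) :
    x ≤ (1 + η) * y := by
  have hL : 0 < Real.log (1 + η) := Real.log_pos (by linarith)
  have h1 := Nat.lt_floor_add_one (Real.log x / Real.log (1 + η))
  have h2 := Nat.floor_le (div_nonneg (Real.log_nonneg hy) hL.le)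
  rw [h] at h1
  have h3 : Real.log x / Real.log (1 + η) < Real.log y / Real.log (1 + η) + 1 := by linarith
  have h4 : Real.log x < Real.log y + Real.log (1 + η) := by
    rw [div_lt_iff₀ hL, add_mul, div_mul_cancel₀ _ hL.ne', one_mul] at h3
    exact h3
  rw [← Real.log_mul (by linarith) (by linarith)] at h4
  rw [mul_comm]
  exact (Real.log_le_log_iff (by linarith) (by nlinarith)).1 h4.le

/-- The number of values of the logarithmic classes is controlled. -/
theorem class_bound {X α k : ℕ} (hα : α + 1 ≤ X) (hX : 3 ≤ X) :
    2 * (⌊Real.log (((α + 1) * X ^ (k + 1) : ℕ) : ℝ) / Real.log (1 + (1 / 2) ^ (k + 1))⌋₊ : ℝ) + 2 ≤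
      (40 * Real.log X) ^ (k + 1) := by
  have hX0 : (0 : ℝ) < X := by positivity
  have hl : 1 ≤ Real.log X := by
    rw [Real.le_log_iff_exp_le hX0]
    have : (3 : ℝ) ≤ X := by exact_mod_cast hX
    linarith [Real.exp_one_lt_d9]
  set η : ℝ := (1 / 2) ^ (k + 1) with hη
  have hη0 : 0 < η := by positivity
  have hη1 : η ≤ 1 := pow_le_one₀ (by norm_num) (by norm_num)
  have hL : η / 2 ≤ Real.log (1 + η) := by
    have h := Real.one_sub_inv_le_log_of_pos (by linarith : 0 < 1 + η)
    refine le_trans ?_ h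
    have : 1 - (1 + η)⁻¹ = η / (1 + η) := by field_simp; ring
    rw [this]
    gcongr
    linarith
  have hlog : Real.log (((α + 1) * X ^ (k + 1) : ℕ) : ℝ) ≤ 2 * (k + 1) * Real.log X := by
    push_cast
    rw [Real.log_mul (by positivity) (by positivity), Real.log_pow]
    have h1 : Real.log ((α : ℝ) + 1) ≤ Real.log X :=
      Real.log_le_log (by positivity) (by exact_mod_cast hα)
    have h2 : 0 ≤ (k : ℝ) * Real.log X := by positivity
    push_cast
    linarith
  have hlog0 : 0 ≤ Real.log (((α + 1) * X ^ (k + 1) : ℕ) : ℝ) := Real.log_natCast_nonneg _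
  have hk : ((k : ℝ) + 1) ≤ 2 ^ (k + 1) := by
    exact_mod_cast (Nat.lt_two_pow_self (n := k + 1)).le
  have h2 : (1 : ℝ) ≤ 2 ^ (k + 1) := one_le_pow₀ (by norm_num)
  have hηi : η * 2 ^ (k + 1) = 1 := by rw [hη, ← mul_pow]; norm_num
  have hmain : Real.log (((α + 1) * X ^ (k + 1) : ℕ) : ℝ) / Real.log (1 + η) ≤
      4 * (2 ^ (k + 1) * 2 ^ (k + 1)) * Real.log X := by
    rw [div_le_iff₀ (by linarith)]
    calc _ ≤ 2 * (k + 1) * Real.log X := hlog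
      _ ≤ 2 * 2 ^ (k + 1) * Real.log X := by gcongr
      _ = 4 * (2 ^ (k + 1)) * Real.log X * (η * 2 ^ (k + 1) / 2) := by rw [hηi]; ring
      _ = 4 * (2 ^ (k + 1) * 2 ^ (k + 1)) * Real.log X * (η / 2) := by ring
      _ ≤ _ := by gcongr
  have hf := Nat.floor_le (div_nonneg hlog0 (by linarith : 0 ≤ Real.log (1 + η)))
  have h4 : (1 : ℝ) ≤ 2 ^ (k + 1) * 2 ^ (k + 1) := by nlinarith
  have h5 : (1 : ℝ) ≤ 2 ^ (k + 1) * 2 ^ (k + 1) * Real.log X := by nlinarith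
  calc _ ≤ 10 * (2 ^ (k + 1) * 2 ^ (k + 1) * Real.log X) := by linarith
    _ = 10 * (4 ^ (k + 1) * Real.log X) := by rw [← mul_pow]; norm_num
    _ ≤ 10 ^ (k + 1) * (4 ^ (k + 1) * Real.log X ^ (k + 1)) := by
        gcongr
        · exact le_self_pow₀ (by norm_num) (by omega)
        · exact le_self_pow₀ hl (by omega)
    _ = _ := by rw [← mul_pow, ← mul_pow]; congr 1; ring

theorem two_le_length {A : Finset ℕ} {α : ℕ} (hα : ∀ d ∈ A, d ≤ α) {w : List ℕ}
    (hw : ∀ d ∈ w, d ∈ A) (h1 : (α : ℤ) + 1 < cfDen w) : 2 ≤ w.length := by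
  match w, hw, h1 with
  | [], _, h1 =>
    simp [cfDen, cfMat] at h1
    omega
  | [a], hw, h1 =>
    have := hα a (hw a (by simp))
    simp [cfDen, cfMat] at h1
    omega
  | a :: b :: l, _, _ => simp

open Real in
theorem exists_block {A : Finset ℕ} (hA : 0 ∉ A) {X α k : ℕ} (hα : ∀ d ∈ A, d ≤ α)
    (hXα : 2 * (α + 1) ≤ X) (hX : 3 ≤ X) (hlog : 40 * log X ≤ (X : ℝ) ^ (0.0028 : ℝ))
    (hcount : ((X ^ (k + 1) : ℕ) : ℝ) ^ (1.854 : ℝ) ≤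
      (wordsBetween A α (X ^ (k + 1))).ncard) :
    ∃ F : Finset (List ℕ), Uniform F ∧ (∀ w ∈ F, ∀ d ∈ w, d ∈ A) ∧
      Pinned (1 + (1 / 2) ^ (k + 1)) F ∧ (∀ w ∈ F, (X : ℤ) ^ (k + 1) ≤ cfDen w) ∧
      (∀ w ∈ F, 2 * cfDen w ≤ (X : ℤ) ^ (k + 2)) ∧
      (X : ℝ) ^ (46 * (k + 1)) ≤ (F.card : ℝ) ^ 25 := by
  classical
  set Y := X ^ (k + 1) with hY
  have hfin := finite_wordsBetween hA α Y
  set W := hfin.toFinset with hW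
  have hWmem : ∀ {w}, w ∈ W ↔ w ∈ wordsBetween A α Y := hfin.mem_toFinset
  have hWcard : ((wordsBetween A α Y).ncard : ℝ) = W.card := by
    rw [Set.ncard_eq_toFinset_card _ hfin]
  have hXY : X ≤ Y := Nat.le_self_pow (by omega) X
  have hpos : ∀ w ∈ W, ∀ d ∈ w, 1 ≤ d := fun w hw d hd =>
    Nat.pos_of_ne_zero fun h => hA (h ▸ (hWmem.1 hw).1 d hd)
  have hent : ∀ w ∈ W, ∀ i j, 1 ≤ cfMat w i j := fun w hw =>
    cfMat_pos (hpos w hw) (two_le_length hα (hWmem.1 hw).1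
      (lt_of_lt_of_le (by exact_mod_cast (by omega : α + 1 < Y)) (hWmem.1 hw).2.1))
  set η : ℝ := (1 / 2) ^ (k + 1) with hη
  have hη0 : 0 < η := by positivity
  have hη1 : η ≤ 1 := pow_le_one₀ (by norm_num) (by norm_num)
  have hL : 0 < log (1 + η) := log_pos (by linarith)
  set c : ℤ → ℕ := fun x => ⌊log x / log (1 + η)⌋₊ with hc
  set M := ⌊log (((α + 1) * Y : ℕ) : ℝ) / log (1 + η)⌋₊ with hM
  have hcM : ∀ w ∈ W, ∀ i j, c (cfMat w i j) < 2 * M + 2 := by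
    intro w hw i j
    have h1 := (cfMat_le_cfDen (hpos w hw) i j).trans (hWmem.1 hw).2.2
    have h2 := hent w hw i j
    have h3 : c (cfMat w i j) ≤ M := by
      refine Nat.floor_mono ?_
      gcongr
      exact_mod_cast h1
    omega
  have hlen : ∀ w ∈ W, w.length < 2 * M + 2 := by
    intro w hw
    have h1 := length_le_of_cfDen_le (hpos w hw) (hWmem.1 hw).2.2
    have h2 : Nat.log 2 ((α + 1) * Y) ≤ M := by
      refine Nat.le_floor ?_
      have h3 : 0 < (α + 1) * Y := by positivity
      have h4 : 2 ^ Nat.log 2 ((α + 1) * Y) ≤ (α + 1) * Y := Nat.pow_log_le_self 2 h3.ne'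
      have h5 : Real.log ((2 : ℝ) ^ Nat.log 2 ((α + 1) * Y)) ≤ log (((α + 1) * Y : ℕ) : ℝ) :=
        Real.log_le_log (by positivity) (by exact_mod_cast h4)
      rw [Real.log_pow] at h5
      rw [le_div_iff₀ hL]
      refine le_trans ?_ h5
      gcongr
      linarith
    omega
  set N := 2 * M + 2 with hN
  set φ : List ℕ → ℕ × ℕ × ℕ × ℕ × ℕ := fun w =>
    (w.length, c (cfMat w 0 0), c (cfMat w 0 1), c (cfMat w 1 0), c (cfMat w 1 1)) with hφ
  set R := Finset.range N
  set S := R ×ˢ R ×ˢ R ×ˢ R ×ˢ R with hS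
  have hScard : (S.card : ℝ) = (N : ℝ) ^ 5 := by
    simp only [hS, Finset.card_product, R, Finset.card_range]; push_cast; ring
  have hN0 : (0 : ℝ) < N := by positivity
  obtain ⟨y, -, hy⟩ := Finset.exists_le_card_fiber_of_nsmul_le_card_of_maps_to (s := W) (t := S)
    (f := φ) (b := (W.card : ℝ) / (N : ℝ) ^ 5) (fun w hw => by
      simp only [hS, hφ, Finset.mem_product, R, Finset.mem_range]
      exact ⟨hlen w hw, hcM w hw _ _, hcM w hw _ _, hcM w hw _ _, hcM w hw _ _⟩)
    (Finset.card_pos.1 (by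
      have : (0 : ℝ) < S.card := by rw [hScard]; positivity
      exact_mod_cast this)) (by
      rw [nsmul_eq_mul, hScard, mul_div_cancel₀ _ (by positivity)])
  set F := W.filter fun w => φ w = y with hF
  have hFW : ∀ w ∈ F, w ∈ W := fun w hw => (Finset.mem_filter.1 hw).1
  have hφeq : ∀ w ∈ F, ∀ w' ∈ F, φ w = φ w' := fun w hw w' hw' =>
    (Finset.mem_filter.1 hw).2.trans (Finset.mem_filter.1 hw').2.symm
  refine ⟨F, fun w hw w' hw' => congrArg Prod.fst (hφeq w hw w' hw'),
    fun w hw => (hWmem.1 (hFW w hw)).1, fun w hw w' hw' i j => ?_,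
    fun w hw => by exact_mod_cast (hWmem.1 (hFW w hw)).2.1, fun w hw => ?_, ?_⟩
  · have h := hφeq w hw w' hw'
    simp only [hφ, Prod.mk.injEq] at h
    refine le_mul_of_floor_log_eq hη0 (by exact_mod_cast hent w (hFW w hw) i j)
      (by exact_mod_cast hent w' (hFW w' hw') i j) ?_
    fin_cases i <;> fin_cases j
    exacts [h.2.1, h.2.2.1, h.2.2.2.1, h.2.2.2.2]
  · have h1 := (hWmem.1 (hFW w hw)).2.2
    have h2 : 2 * (α + 1) * Y ≤ X * Y := Nat.mul_le_mul_right _ hXα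
    have h3 : ((2 * (α + 1) * Y : ℕ) : ℤ) ≤ (X * Y : ℕ) := by exact_mod_cast h2
    rw [hY] at h1 h3
    push_cast at h1 h3
    rw [pow_succ (n := k + 1)]
    linarith
  · have hX0 : (0 : ℝ) < X := by positivity
    have hb : (N : ℝ) ≤ ((X : ℝ) ^ (0.0028 : ℝ)) ^ (k + 1) := by
      have h1 := class_bound (k := k) (by omega : α + 1 ≤ X) hX
      have h2 : (40 * log X) ^ (k + 1) ≤ ((X : ℝ) ^ (0.0028 : ℝ)) ^ (k + 1) :=
        pow_le_pow_left₀ (by positivity) hlog _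
      rw [hN]
      push_cast
      exact h1.trans h2
    have hpw : ∀ r : ℝ, ((X : ℝ) ^ r) ^ (k + 1) = (X : ℝ) ^ (r * ((k + 1 : ℕ) : ℝ)) := fun r => by
      rw [Real.rpow_mul hX0.le, Real.rpow_natCast]
    rw [hpw] at hb
    have hb5 : (N : ℝ) ^ 5 ≤ (X : ℝ) ^ (0.014 * ((k + 1 : ℕ) : ℝ)) := by
      refine (pow_le_pow_left₀ hN0.le hb 5).trans_eq ?_
      rw [← Real.rpow_natCast, ← Real.rpow_mul hX0.le]
      congr 1
      push_cast
      ring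
    have hYr : ((Y : ℕ) : ℝ) ^ (1.854 : ℝ) = (X : ℝ) ^ (1.854 * ((k + 1 : ℕ) : ℝ)) := by
      rw [hY]; push_cast
      rw [← Real.rpow_natCast, ← Real.rpow_mul hX0.le, mul_comm]; push_cast; rfl
    have hFc : (X : ℝ) ^ (1.84 * ((k + 1 : ℕ) : ℝ)) ≤ F.card := by
      refine le_trans ?_ hy
      rw [le_div_iff₀ (by positivity)]
      rw [hWcard, hYr] at hcount
      refine le_trans ?_ hcount
      calc _ ≤ (X : ℝ) ^ (1.84 * ((k + 1 : ℕ) : ℝ)) * (X : ℝ) ^ (0.014 * ((k + 1 : ℕ) : ℝ)) := by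
            gcongr
        _ = _ := by rw [← Real.rpow_add hX0]; congr 1; ring
    refine le_trans (le_of_eq ?_) (pow_le_pow_left₀ (by positivity) hFc 25)
    rw [← Real.rpow_natCast, ← Real.rpow_natCast, ← Real.rpow_mul hX0.le]
    congr 1
    push_cast
    ring

open Filter in
theorem eventually_exists_isBlockSeq {A : Finset ℕ} (hA : 0 ∉ A) {α : ℕ} (hα : ∀ d ∈ A, d ≤ α)
    (hs : ((927 / 1000 : NNReal) : ENNReal) < dimH (Eset A)) :
    ∀ᶠ X : ℕ in atTop, ∃ B, IsBlockSeq A X B := by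
  obtain ⟨Y₀, hY₀⟩ := eventually_atTop.1 (eventually_le_ncard_wordsBetween hA hα hs)
  have h1 := (isLittleO_log_rpow_atTop (r := 0.0028) (by norm_num)).def
    (by norm_num : (0 : ℝ) < 1 / 40)
  filter_upwards [tendsto_natCast_atTop_atTop.eventually h1, eventually_ge_atTop Y₀,
    eventually_ge_atTop (2 * (α + 1)), eventually_ge_atTop 3] with X hl hX1 hX2 hX3
  have hl' : 40 * Real.log X ≤ (X : ℝ) ^ (0.0028 : ℝ) := by
    rw [Real.norm_of_nonneg (Real.log_natCast_nonneg _),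
      Real.norm_of_nonneg (by positivity)] at hl
    linarith
  have h2 : ∀ k : ℕ, ((X ^ (k + 1) : ℕ) : ℝ) ^ (1.854 : ℝ) ≤
      (wordsBetween A α (X ^ (k + 1))).ncard := fun k => by
    have := hY₀ (X ^ (k + 1)) (hX1.trans (Nat.le_self_pow (by omega) X))
    convert this using 2
    norm_num
  choose B h using fun k => exists_block (k := k) hA hα hX2 hX3 hl' (h2 k)
  exact ⟨B, fun k => (h k).1, fun k => (h k).2.1, fun k => (h k).2.2.1, fun k => (h k).2.2.2.1,
    fun k => (h k).2.2.2.2.1, fun k => (h k).2.2.2.2.2⟩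

/-! ### Denominators -/

theorem cfValue_mul_eq : ∀ {w : List ℕ}, (∀ d ∈ w, 1 ≤ d) →
    cfValue w * (cfMat w 1 1 : ℚ) = (cfMat w 0 1 : ℚ)
  | [], _ => by simp [cfValue, cfMat]
  | a :: l, h => by
    have hl : ∀ d ∈ l, 1 ≤ d := fun d hd => h d (by simp [hd])
    have ih := cfValue_mul_eq hl
    have h1 : (1 : ℚ) ≤ cfMat l 1 1 := by exact_mod_cast one_le_cfDen hl
    have h2 : (0 : ℚ) ≤ cfMat l 0 1 := by exact_mod_cast cfMat_nonneg hl 0 1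
    have ha : (1 : ℚ) ≤ a := by exact_mod_cast h a (by simp)
    have h3 : 0 ≤ cfValue l := nonneg_of_mul_nonneg_left (ih ▸ h2) (by linarith)
    rw [cfValue, cfMat_cons_one, cfMat_cons_zero]
    push_cast
    rw [← ih]
    have : (a : ℚ) + cfValue l ≠ 0 := by positivity
    field_simp
    ring

theorem cfDen_mem_Dset {A : Finset ℕ} (hA : 0 ∉ A) {w : List ℕ} (hw : ∀ d ∈ w, d ∈ A)
    (h0 : w ≠ []) {N : ℕ} (hN : cfDen w ≤ N) : (cfDen w).toNat ∈ Dset A N := by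
  have hpos := IsBlockSeq.pos_of_mem hA hw
  have h1 := one_le_cfDen hpos
  have h2 := cfMat_nonneg hpos 0 1
  refine ⟨by omega, (cfMat w 0 1).toNat, ?_, w, h0, hw, ?_⟩
  · have h3 := Int.isCoprime_iff_gcd_eq_one.1 (isCoprime_cfMat_col w)
    rw [Int.gcd_eq_natAbs] at h3
    convert h3 using 2 <;> simp only [cfDen] at * <;> omega
  · have e1 : (((cfDen w).toNat : ℕ) : ℚ) = cfMat w 1 1 := by
      exact_mod_cast Int.toNat_of_nonneg (zero_le_one.trans h1)
    have e2 : (((cfMat w 0 1).toNat : ℕ) : ℚ) = cfMat w 0 1 := by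
      exact_mod_cast Int.toNat_of_nonneg h2
    have h4 : (1 : ℚ) ≤ cfMat w 1 1 := by exact_mod_cast h1
    rw [e1, e2, eq_div_iff (by linarith), cfValue_mul_eq hpos]

theorem card_image_cfDen_le {A : Finset ℕ} (hA : 0 ∉ A) {Ω : Finset (List ℕ)}
    (hΩ : ∀ w ∈ Ω, ∀ d ∈ w, d ∈ A) (h0 : ∀ w ∈ Ω, w ≠ []) {N : ℕ} (hN : ∀ w ∈ Ω, cfDen w ≤ N) :
    (Ω.image cfDen).card ≤ (Dset A N).ncard := by
  have hfin : (Dset A N).Finite := (Set.finite_Iic N).subset fun d hd => hd.1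
  have hinj : Set.InjOn Int.toNat (Ω.image cfDen : Finset ℤ) := by
    intro a ha b hb hab
    obtain ⟨w, hw, rfl⟩ := Finset.mem_image.1 (Finset.mem_coe.1 ha)
    obtain ⟨w', hw', rfl⟩ := Finset.mem_image.1 (Finset.mem_coe.1 hb)
    have h1 := one_le_cfDen (IsBlockSeq.pos_of_mem hA (hΩ w hw))
    have h2 := one_le_cfDen (IsBlockSeq.pos_of_mem hA (hΩ w' hw'))
    omega
  rw [← Finset.card_image_of_injOn hinj, ← Set.ncard_coe_finset]
  refine Set.ncard_le_ncard ?_ hfin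
  intro d hd
  obtain ⟨a, ha, rfl⟩ := Finset.mem_image.1 (Finset.mem_coe.1 hd)
  obtain ⟨w, hw, rfl⟩ := Finset.mem_image.1 ha
  exact cfDen_mem_Dset hA (hΩ w hw) (h0 w hw) (hN w hw)

/-! ### Choice of the parameters -/

theorem exists_scale {X N : ℕ} (hX : 2 ≤ X) (hN : X ^ (245 * 600 ^ 2 + 42 * 600 + 1) ≤ N) :
    ∃ I, 600 ≤ I ∧ X ^ (245 * I ^ 2 + 42 * I + 1) ≤ N ∧
      N < X ^ (245 * (I + 1) ^ 2 + 42 * (I + 1) + 1) := by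
  have hmono : ∀ {a b : ℕ}, a ≤ b →
      X ^ (245 * a ^ 2 + 42 * a + 1) ≤ X ^ (245 * b ^ 2 + 42 * b + 1) := fun h =>
    Nat.pow_le_pow_right (by omega) (by gcongr)
  have hex : ∃ J, N < X ^ (245 * J ^ 2 + 42 * J + 1) := by
    refine ⟨N, (Nat.lt_pow_self (by omega : 1 < X)).trans_le (Nat.pow_le_pow_right (by omega) ?_)⟩
    nlinarith
  have h1 := Nat.find_spec hex
  have h2 : 600 < Nat.find hex := by
    by_contra hn
    exact absurd (h1.trans_le (hmono (not_lt.1 hn))) (not_lt.2 hN)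
  obtain ⟨I, hI⟩ : ∃ I, Nat.find hex = I + 1 := ⟨Nat.find hex - 1, by omega⟩
  refine ⟨I, by omega, not_lt.1 (Nat.find_min hex (by omega)), ?_⟩
  rwa [hI] at h1

theorem cfDen_insert_le {l r : List ℕ} {α : ℕ} (hl : ∀ d ∈ l, 1 ≤ d) (hr : ∀ d ∈ r, 1 ≤ d)
    (hα : 1 ≤ α) : cfDen (l ++ (α :: r)) ≤ 4 * α * cfDen (l ++ r) := by
  have hα' : ∀ d ∈ [α], 1 ≤ d := by simpa using hα
  have e : cfDen [α] = α := by simp [cfDen, cfMat]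
  have h1 := cfDen_append_le hl (l' := α :: r) (by simpa using ⟨hα, hr⟩)
  have h2 := cfDen_append_le hα' hr
  have h3 := cfDen_mul_le hl hr
  have h4 := one_le_cfDen hl
  rw [e, List.singleton_append] at h2
  have h5 := mul_le_mul_of_nonneg_left h2 (by linarith : 0 ≤ cfDen l)
  have h6 := mul_le_mul_of_nonneg_left h3 (by positivity : (0 : ℤ) ≤ 4 * α)
  linarith

theorem exists_filler {l r : List ℕ} {α N : ℕ} (hl : ∀ d ∈ l, 1 ≤ d) (hr : ∀ d ∈ r, 1 ≤ d)
    (hα : 1 ≤ α) (hN : 9 * cfDen (l ++ r) ≤ N) :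
    ∃ m : ℕ, 9 * cfDen (l ++ (List.replicate m α ++ r)) ≤ N ∧
      (N : ℤ) ≤ 36 * α * cfDen (l ++ (List.replicate m α ++ r)) := by
  have hm : ∀ m, ∀ d ∈ List.replicate m α, 1 ≤ d := fun m d hd =>
    (List.eq_of_mem_replicate hd).symm ▸ hα
  have hmr : ∀ m, ∀ d ∈ List.replicate m α ++ r, 1 ≤ d := fun m d hd => by
    rcases List.mem_append.1 hd with h | h
    exacts [hm m d h, hr d h]
  have hex : ∃ m, (N : ℤ) < 9 * cfDen (l ++ (List.replicate m α ++ r)) := by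
    refine ⟨2 * N, ?_⟩
    have h1 := two_pow_le_cfDen (hm (2 * N))
    have h2 : (List.replicate (2 * N) α).length / 2 = N := by simp
    rw [h2] at h1
    have h3 : ((N : ℕ) : ℤ) < 2 ^ N := by exact_mod_cast Nat.lt_two_pow_self
    have h4 := cfDen_mul_le hl (hmr (2 * N))
    have h5 := cfDen_mul_le (hm (2 * N)) hr
    have h6 := one_le_cfDen hl
    have h7 := one_le_cfDen hr
    have h8 := one_le_cfDen (hm (2 * N))
    have h9 := one_le_cfDen (hmr (2 * N))
    nlinarith
  have h1 := Nat.find_spec hex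
  obtain ⟨m, hm'⟩ : ∃ m, Nat.find hex = m + 1 := by
    refine ⟨Nat.find hex - 1, ?_⟩
    rcases Nat.eq_zero_or_pos (Nat.find hex) with h | h
    · rw [h] at h1
      simp at h1
      omega
    · omega
  refine ⟨m, not_lt.1 (Nat.find_min hex (by omega)), ?_⟩
  rw [hm', List.replicate_succ, List.cons_append] at h1
  have h2 := cfDen_insert_le hl (hmr m) hα
  linarith

open Filter in
theorem exists_isEnsemble {A : Finset ℕ} (hcard : 2 ≤ A.card) (hA : 0 ∉ A)
    (hs : ((927 / 1000 : NNReal) : ENNReal) < dimH (Eset A)) :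
    ∃ X α N₀ : ℕ, ∀ N, N₀ ≤ N → ∃ (I : ℕ) (B : ℕ → Finset (List ℕ)) (f w₀ : List ℕ),
      IsEnsemble A X α I B f w₀ ∧ 9 * cfDen w₀ ≤ N ∧ (N : ℤ) ≤ 36 * α * cfDen w₀ := by
  have hne : A.Nonempty := Finset.card_pos.1 (by omega)
  set α := A.max' hne with hαdef
  have hαA : α ∈ A := A.max'_mem hne
  have hα : ∀ d ∈ A, d ≤ α := fun d hd => A.le_max' d hd
  have hα1 : 1 ≤ α := Nat.pos_of_ne_zero fun h => hA (h ▸ hαA)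
  obtain ⟨X, ⟨B, hB⟩, hX⟩ := ((eventually_exists_isBlockSeq hA hα hs).and
    (eventually_ge_atTop (13200 * (α + 1)))).exists
  refine ⟨X, α, X ^ (245 * 600 ^ 2 + 42 * 600 + 1), fun N hN => ?_⟩
  obtain ⟨I, hI, hI1, hI2⟩ := exists_scale (by omega) hN
  obtain ⟨l, hl⟩ := hB.nonempty_blockCat (by omega) (List.range (7 * I))
  obtain ⟨r, hr⟩ := hB.nonempty_blockCat (by omega) (List.range (21 * I)).reverse
  have hlp := IsBlockSeq.pos_of_mem hA (hB.letters_blockCat _ l hl)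
  have hrp := IsBlockSeq.pos_of_mem hA (hB.letters_blockCat _ r hr)
  have l1 := one_le_cfDen hlp
  have r1 := one_le_cfDen hrp
  have l2 := hB.cfDen_blockCat_le hA _ l hl
  have r2 := hB.cfDen_blockCat_le hA _ r hr
  have l3 := hB.le_cfDen_blockCat hA _ l hl
  have r3 := hB.le_cfDen_blockCat hA _ r hr
  rw [sum_map_reverse] at r2 r3
  have el2 := two_mul_sum_range_add_two (7 * I)
  have er2 := two_mul_sum_range_add_two (21 * I)
  have el1 := two_mul_sum_range_add_one (7 * I)
  have er1 := two_mul_sum_range_add_one (21 * I)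
  have hX0 : (0 : ℤ) < X := by exact_mod_cast (by omega : 0 < X)
  have hX18 : (18 : ℤ) ≤ X := by exact_mod_cast (by omega : 18 ≤ X)
  have hlr : 9 * cfDen (l ++ r) ≤ N := by
    have h1 := cfDen_append_le hlp hrp
    have h2 := mul_le_mul l2 r2 (by linarith) (by positivity)
    rw [← pow_add] at h2
    have h3 : ((List.range (7 * I)).map (· + 2)).sum + ((List.range (21 * I)).map (· + 2)).sum =
        245 * I ^ 2 + 42 * I := by nlinarith
    rw [h3] at h2
    have h4 : ((X ^ (245 * I ^ 2 + 42 * I + 1) : ℕ) : ℤ) ≤ N := by exact_mod_cast hI1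
    push_cast at h4
    rw [pow_succ] at h4
    have h5 := mul_le_mul_of_nonneg_left hX18
      (by positivity : (0 : ℤ) ≤ (X : ℤ) ^ (245 * I ^ 2 + 42 * I))
    linarith
  obtain ⟨m, hm1, hm2⟩ := exists_filler hlp hrp hα1 hlr
  have hfA : ∀ d ∈ List.replicate m α, d ∈ A := fun d hd =>
    (List.eq_of_mem_replicate hd).symm ▸ hαA
  have hfp := IsBlockSeq.pos_of_mem hA hfA
  refine ⟨I, B, List.replicate m α, _, ⟨hB, hA, hα, hX, by omega, hfA, ?_, ?_⟩, hm1, hm2⟩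
  · have f1 := one_le_cfDen hfp
    have h1 := cfDen_mul_le hlp (l' := List.replicate m α ++ r) (fun d hd => by
      rcases List.mem_append.1 hd with h | h
      exacts [hfp d h, hrp d h])
    have h2 := mul_le_mul_of_nonneg_left (cfDen_mul_le hfp hrp) (by linarith : 0 ≤ cfDen l)
    have h3 : (X : ℤ) ^ (245 * I ^ 2 + 14 * I) ≤ cfDen l * cfDen r := by
      have h := mul_le_mul l3 r3 (by positivity) (by linarith)
      have e : ((List.range (7 * I)).map (· + 1)).sum + ((List.range (21 * I)).map (· + 1)).sum =
          245 * I ^ 2 + 14 * I := by nlinarith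
      rwa [← pow_add, e] at h
    have h4 := mul_le_mul_of_nonneg_left h3 (by linarith : 0 ≤ cfDen (List.replicate m α))
    have h5 : (N : ℤ) < (X ^ (245 * (I + 1) ^ 2 + 42 * (I + 1) + 1) : ℕ) := by exact_mod_cast hI2
    have h6 : X ^ (245 * (I + 1) ^ 2 + 42 * (I + 1) + 1) ≤
        X ^ (I ^ 2 + (245 * I ^ 2 + 14 * I)) :=
      Nat.pow_le_pow_right (by omega) (by nlinarith)
    have h7 : ((X ^ (245 * (I + 1) ^ 2 + 42 * (I + 1) + 1) : ℕ) : ℤ) ≤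
      (X ^ (I ^ 2 + (245 * I ^ 2 + 14 * I)) : ℕ) := by exact_mod_cast h6
    have h8 : ((X ^ (I ^ 2 + (245 * I ^ 2 + 14 * I)) : ℕ) : ℤ) =
      (X : ℤ) ^ (I ^ 2) * (X : ℤ) ^ (245 * I ^ 2 + 14 * I) := by push_cast; rw [pow_add]
    refine le_of_mul_le_mul_right (a := (X : ℤ) ^ (245 * I ^ 2 + 14 * I)) ?_ (by positivity)
    rw [← h8]
    calc _ ≤ cfDen l * (cfDen (List.replicate m α) * cfDen r) := by linarith
      _ ≤ _ := by linarith
  · exact mem_cat.2 ⟨l, hl, _, mem_cat.2 ⟨_, Finset.mem_singleton_self _, r, hr, rfl⟩, rfl⟩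

theorem positive_proportion_of_dimH_gt
    (A : Finset ℕ) (hcard : 2 ≤ A.card) (hpos : 0 ∉ A)
    (hdim : ENNReal.ofReal (1 - 1 / (8 + Real.sqrt 34)) < dimH (Eset A)) :
    ∃ c : ℝ, 0 < c ∧ ∃ N₀ : ℕ, ∀ N : ℕ, N₀ ≤ N →
      c * (N : ℝ) ≤ ((Dset A N).ncard : ℝ) := by
  obtain ⟨X, α, N₀, h⟩ := exists_isEnsemble hcard hpos (coe_lt_of_ofReal_lt hdim)
  set C : ℝ := appBound (X ^ (66 * 100 ^ 2)) + 3 * (1024 * 43 * 81) with hC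
  have hC0 : 0 < C := by
    have : (0 : ℝ) ≤ appBound (X ^ (66 * 100 ^ 2)) := Nat.cast_nonneg _
    linarith
  refine ⟨1 / (36 * (α + 1) * C), by positivity, N₀, fun N hN => ?_⟩
  obtain ⟨I, B, f, w₀, hE, h1, h2⟩ := h N hN
  have h3 := hE.cfDen_le_card_image
  have h4 : ((ens B I f).image cfDen).card ≤ (Dset A N).ncard :=
    card_image_cfDen_le hpos
      (letters_cat (hE.blocks.letters_blockCat _)
        (letters_cat (by simpa using hE.f_letters) (hE.blocks.letters_blockCat _)))
      (fun w hw => hE.ne_nil_of_mem hw) fun w hw => (hE.cfDen_le_of_mem hw).trans h1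
  have h5 : (((ens B I f).image cfDen).card : ℝ) ≤ (Dset A N).ncard := by exact_mod_cast h4
  have h6 : (N : ℝ) ≤ 36 * α * cfDen w₀ := by exact_mod_cast h2
  have h7 : (1 : ℝ) ≤ cfDen w₀ := by
    exact_mod_cast one_le_cfDen (hE.pos_left _ _ w₀ hE.w₀_mem)
  rw [one_div_mul_eq_div, div_le_iff₀ (by positivity)]
  have hα0 : (0 : ℝ) ≤ α := by positivity
  calc (N : ℝ) ≤ 36 * α * cfDen w₀ := h6
    _ ≤ 36 * (α + 1) * cfDen w₀ := by gcongr; linarith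
    _ ≤ 36 * (α + 1) * (C * (Dset A N).ncard) := by
        have := h3.trans (mul_le_mul_of_nonneg_left h5 hC0.le)
        gcongr
    _ = _ := by ring
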